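/- Let d ≥ 2. For every real p ∈ [1, ∞) there exists a constant C(d, p) ≥ 1 such that for every integer n ∈ ℕ*: (1/C(d,p)) · n^{(1/2)(d/2 − 1 + d/p)} ≤ ‖√(e_d(n, ·))‖_{L^p(ℝ^d)} ≤ C(d,p) · n^{(1/2)(d/2 − 1 + d/p)}. -/

import Mathlib

open MeasureTheory
open scoped ENNReal NNReal

/-- The `n`-th physicists' Hermite polynomial `H_n(x) = (−1)^n e^{x²} (d/dx)^n e^{−x²}`. -/
noncomputable def hermitePoly (n : ℕ) (x : ℝ) : ℝ :=
  (-1 : ℝ) ^ n * Real.exp (x ^ 2) * iteratedDeriv n (fun t => Real.exp (-t ^ 2)) x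

/-- The `n`-th (L²-normalized) Hermite function
`h_n(x) = H_n(x) e^{−x²/2} / √(n! 2^n √π)`. -/
noncomputable def hermiteFun (n : ℕ) (x : ℝ) : ℝ :=
  hermitePoly n x * Real.exp (-x ^ 2 / 2) /
    Real.sqrt ((n.factorial : ℝ) * 2 ^ n * Real.sqrt Real.pi)

/-- The spectral function of the `n`-th eigenspace of the harmonic oscillator `−Δ + |x|²`
on `ℝ^d`: `e_d(n, x) = ∑_{i₁+⋯+i_d = n} h_{i₁}(x₁)² ⋯ h_{i_d}(x_d)²`. -/
noncomputable def eSpec (d n : ℕ) (x : Fin d → ℝ) : ℝ :=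
  ∑ i ∈ Finset.Nat.antidiagonalTuple d n, ∏ k, (hermiteFun (i k) (x k)) ^ 2


noncomputable def Hq : ℕ → Polynomial ℝ
  | 0 => 1
  | (n+1) => 2 * Polynomial.X * Hq n - Polynomial.derivative (Hq n)

lemma Hq_deriv (n : ℕ) : Polynomial.derivative (Hq (n+1)) = 2 * (n+1 : Polynomial ℝ) * Hq n := by
  induction n with
  | zero => simp [Hq]
  | succ n ih =>
    rw [Hq]
    simp only [Polynomial.derivative_sub, Polynomial.derivative_mul, ih]
    have h : Hq (n+1) = 2 * Polynomial.X * Hq n - Polynomial.derivative (Hq n) := rfl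
    simp
    linear_combination (-2 * ((n:Polynomial ℝ) + 1)) * h

lemma Hq_rec (n : ℕ) : Hq (n+2) = 2 * Polynomial.X * Hq (n+1) - 2 * (n+1 : Polynomial ℝ) * Hq n := by
  rw [Hq, Hq_deriv]

lemma iter_gauss (n : ℕ) : iteratedDeriv n (fun t : ℝ => Real.exp (-t ^ 2)) =
    fun x => (-1 : ℝ) ^ n * (Hq n).eval x * Real.exp (-x ^ 2) := by
  induction n with
  | zero => simp [Hq]
  | succ n ih =>
    rw [iteratedDeriv_succ, ih]
    funext x
    have h1 : HasDerivAt (fun x : ℝ => Real.exp (-x ^ 2)) (Real.exp (-x^2) * (-(2 * x))) x := by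
      have := ((hasDerivAt_pow 2 x).neg).exp
      simpa using this
    have h2 := (((Hq n).hasDerivAt x).const_mul ((-1:ℝ)^n)).mul h1
    have h3 := h2.deriv
    simp only [Pi.mul_def] at h3
    rw [h3, Hq]
    simp
    ring

lemma hermitePoly_eq (n : ℕ) (x : ℝ) : hermitePoly n x = (Hq n).eval x := by
  rw [hermitePoly, iter_gauss]
  have h1 : ((-1:ℝ)^n) * (-1)^n = 1 := by rw [← mul_pow]; simp
  have h2 : Real.exp (x^2) * Real.exp (-x^2) = 1 := by rw [← Real.exp_add]; simp
  linear_combination ((Hq n).eval x) * (Real.exp (x^2) * Real.exp (-x^2)) * h1 + (Hq n).eval x * h2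

noncomputable def ha (n : ℕ) (x : ℝ) : ℝ := (hermiteFun n x)^2

lemma ha_nonneg (n : ℕ) (x : ℝ) : 0 ≤ ha n x := sq_nonneg _

lemma ha_eq (n : ℕ) (x : ℝ) : ha n x =
    (Hq n).eval x ^ 2 * Real.exp (-x^2) / ((n.factorial : ℝ) * 2 ^ n * Real.sqrt Real.pi) := by
  rw [ha, hermiteFun, hermitePoly_eq, div_pow, Real.sq_sqrt (by positivity), mul_pow,
    ← Real.exp_nat_mul]
  congr 3
  push_cast; ring

lemma ha_zero (x : ℝ) : ha 0 x = Real.exp (-x^2) / Real.sqrt Real.pi := by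
  rw [ha_eq]; simp [Hq]

lemma ha_one (x : ℝ) : ha 1 x = 2 * x^2 * ha 0 x := by
  rw [ha_eq, ha_eq]; simp [Hq]; field_simp

lemma ha_two (x : ℝ) : 2 * ha 2 x = (2 * x^2 - 1) * ha 1 x + (1 - 2 * x^2) * ha 0 x := by
  rw [ha_eq, ha_eq, ha_eq]
  have : (0:ℝ) < Real.sqrt Real.pi := by positivity
  simp [Hq, Nat.factorial]
  field_simp
  ring

lemma ha_rec (n : ℕ) (x : ℝ) : (n+3) * ha (n+3) x + (n+2 - 2*x^2) * ha (n+2) x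
    - (n + 2 - 2*x^2) * ha (n+1) x - (n+1) * ha n x = 0 := by
  have e1 : (Hq (n+2)).eval x = 2 * x * (Hq (n+1)).eval x - 2 * (n+1) * (Hq n).eval x := by
    rw [Hq_rec]; simp
  have e2 : (Hq (n+3)).eval x = 2 * x * (Hq (n+2)).eval x - 2 * (n+2) * (Hq (n+1)).eval x := by
    have h := congrArg (Polynomial.eval x) (Hq_rec (n+1))
    simp only [Polynomial.eval_sub, Polynomial.eval_mul, Polynomial.eval_X, Polynomial.eval_add,
      Polynomial.eval_ofNat, Polynomial.eval_one, Polynomial.eval_natCast] at h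
    push_cast at h
    rw [h]; ring
  have : (0:ℝ) < Real.sqrt Real.pi := by positivity
  have hf : (0:ℝ) < n.factorial := by positivity
  rw [ha_eq, ha_eq, ha_eq, ha_eq, e2, e1]
  simp only [Nat.factorial_succ]
  push_cast
  have h1 : (n:ℝ)+1 ≠ 0 := by positivity
  have h2 : (n:ℝ)+1+1 ≠ 0 := by positivity
  have h3 : (n:ℝ)+2+1 ≠ 0 := by positivity
  have h4 : (n:ℝ)+2 ≠ 0 := by positivity
  have h5 : (n:ℝ)+3 ≠ 0 := by positivity
  rw [show (n:ℝ)+1+1 = n + 2 by ring, show (n:ℝ)+2+1 = n + 3 by ring]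
  field_simp
  ring

/-- truncated generating function ODE -/
lemma trunc_ode (K : ℕ) (x r : ℝ) :
    (1-r)*(1+r)^2 * (∑ k ∈ Finset.range (K+2), (k:ℝ) * ha k x * r^(k-1))
     - (r*(1+r) + 2*x^2*(1-r)) * (∑ k ∈ Finset.range (K+2), ha k x * r^k)
    = - r^(K+1) * (K+2) * ha (K+2) x
      - r^(K+2) * ((K+2-2*x^2) * ha (K+1) x + (K+1) * ha K x) - r^(K+3) * (K+2) * ha (K+1) x := by
  induction K with
  | zero =>
    simp [Finset.sum_range_succ]
    have := ha_one x
    have := ha_two x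
    linear_combination (1:ℝ) * ha_one x + r * ha_two x
  | succ K ih =>
    rw [Finset.sum_range_succ _ (K+2), Finset.sum_range_succ _ (K+2), mul_add, mul_add]
    have := ha_rec K x
    have e : K + 2 - 1 = K + 1 := by omega
    rw [e]
    push_cast at *
    simp only [show K+1+2 = K+3 from rfl, show K+1+1 = K+2 from rfl]
    linear_combination ih + r^(K+2) * this

noncomputable def gen1 (x r : ℝ) : ℝ :=
  (Real.sqrt Real.pi)⁻¹ * (Real.sqrt (1-r^2))⁻¹ * Real.exp (-x^2*((1-r)/(1+r)))

lemma chernoff1_aux (K : ℕ) (x r : ℝ) (hK : 2*x^2 ≤ K) (hr0 : 0 ≤ r) (hr1 : r < 1) :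
    ∑ k ∈ Finset.range (K+2), ha k x * r^k ≤ gen1 x r := by
  set P : ℝ → ℝ := fun r => ∑ k ∈ Finset.range (K+2), ha k x * r^k with hP
  set φ : ℝ → ℝ := fun r => P r * (Real.sqrt (1-r^2) * Real.exp (x^2*((1-r)/(1+r)))) with hφ
  have hder : ∀ r ∈ Set.Ico (0:ℝ) 1, HasDerivAt φ
      ((∑ k ∈ Finset.range (K+2), (k:ℝ) * ha k x * r^(k-1)) * (Real.sqrt (1-r^2) * Real.exp (x^2*((1-r)/(1+r))))
       + P r * ((-(r / Real.sqrt (1-r^2))) * Real.exp (x^2*((1-r)/(1+r))) +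
         Real.sqrt (1-r^2) * (Real.exp (x^2*((1-r)/(1+r))) * (x^2 * (-2/(1+r)^2))))) r := by
    intro r hr
    have hr1 : 0 < 1 - r^2 := by nlinarith [hr.1, hr.2]
    have hr2 : 1 + r ≠ 0 := by linarith [hr.1]
    have d1 : HasDerivAt P (∑ k ∈ Finset.range (K+2), (k:ℝ) * ha k x * r^(k-1)) r := by
      refine HasDerivAt.fun_sum fun k _ => ?_
      have := (hasDerivAt_pow k r).const_mul (ha k x)
      exact this.congr_deriv (by ring)
    have d2 : HasDerivAt (fun r : ℝ => Real.sqrt (1-r^2)) (-(r / Real.sqrt (1-r^2))) r := by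
      have := ((hasDerivAt_pow 2 r).const_sub 1).sqrt hr1.ne'
      convert this using 1
      field_simp; simp; ring
    have d3 : HasDerivAt (fun r : ℝ => (1-r)/(1+r)) (-2/(1+r)^2) r := by
      have := ((hasDerivAt_id r).const_sub 1).div ((hasDerivAt_id r).const_add 1) hr2
      refine this.congr_deriv ?_
      simp only [id]; ring
    exact d1.mul (d2.mul (d3.const_mul (x^2)).exp)
  have hanti : AntitoneOn φ (Set.Ico 0 1) := by
    apply antitoneOn_of_deriv_nonpos (convex_Ico 0 1)
    · exact fun r hr => (hder r hr).continuousAt.continuousWithinAt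
    · rw [interior_Ico]
      exact fun r hr => (hder r ⟨hr.1.le, hr.2⟩).differentiableAt.differentiableWithinAt
    · rw [interior_Ico]
      intro r hr
      have hr0 := hr.1
      have hr1 := hr.2
      rw [(hder r ⟨hr.1.le, hr.2⟩).deriv]
      have h1 : 0 < 1 - r^2 := by nlinarith
      have h2 : 0 < 1 - r := by linarith
      have h3 : 0 < 1 + r := by linarith
      have hode := trunc_ode K x r
      have hneg : (1-r)*(1+r)^2 * (∑ k ∈ Finset.range (K+2), (k:ℝ) * ha k x * r^(k-1))
         - (r*(1+r) + 2*x^2*(1-r)) * P r ≤ 0 := by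
        rw [hode]
        have a1 := ha_nonneg (K+2) x
        have a2 := ha_nonneg (K+1) x
        have a3 := ha_nonneg K x
        have b1 : 0 ≤ r^(K+1) * (K+2) * ha (K+2) x := by positivity
        have b2 : 0 ≤ r^(K+3) * (K+2) * ha (K+1) x := by positivity
        have b3 : 0 ≤ (K+2-2*x^2) := by linarith
        have b4 : 0 ≤ r^(K+2) * ((K+2-2*x^2) * ha (K+1) x + (K+1) * ha K x) := by positivity
        linarith
      set S := (∑ k ∈ Finset.range (K+2), (k:ℝ) * ha k x * r^(k-1))
      set Ex := Real.exp (x^2*((1-r)/(1+r))) with hEx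
      have hE : 0 < Ex := Real.exp_pos _
      have hs : 0 < Real.sqrt (1-r^2) := Real.sqrt_pos.mpr h1
      have hss : Real.sqrt (1-r^2) ^ 2 = 1 - r^2 := Real.sq_sqrt h1.le
      have key : S * (Real.sqrt (1-r^2) * Ex) + P r * ((-(r / Real.sqrt (1-r^2))) * Ex +
         Real.sqrt (1-r^2) * (Ex * (x^2 * (-2/(1+r)^2)))) =
         Real.sqrt (1-r^2) * Ex / ((1-r)*(1+r)^2) * ((1-r)*(1+r)^2 * S
         - (r*(1+r) + 2*x^2*(1-r)) * P r) := by
        have : r / Real.sqrt (1-r^2) = Real.sqrt (1-r^2) * (r / ((1-r)*(1+r))) := by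
          rw [div_eq_iff hs.ne', show Real.sqrt (1-r^2) * (r / ((1-r)*(1+r))) * Real.sqrt (1-r^2) =
            Real.sqrt (1-r^2)^2 * (r / ((1-r)*(1+r))) by ring, hss]
          field_simp; ring
        rw [this]
        field_simp
        ring
      rw [key]
      apply mul_nonpos_of_nonneg_of_nonpos _ hneg
      positivity
  have h := hanti (Set.mem_Ico.mpr ⟨le_refl 0, one_pos⟩) (Set.mem_Ico.mpr ⟨hr0, hr1⟩) hr0
  have h0 : φ 0 = (Real.sqrt Real.pi)⁻¹ := by
    have : P 0 = ha 0 x := by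
      rw [hP]; simp [Finset.sum_range_succ', zero_pow]
    simp only [hφ, this, ha_zero]
    have h2 : Real.exp (-x^2) * Real.exp (x^2) = 1 := by rw [← Real.exp_add]; simp
    simp
    field_simp
    linarith
  rw [h0] at h
  have h1 : 0 < 1 - r^2 := by nlinarith
  have hs : 0 < Real.sqrt (1-r^2) := Real.sqrt_pos.mpr h1
  have h2 : Real.exp (-x^2*((1-r)/(1+r))) * Real.exp (x^2*((1-r)/(1+r))) = 1 := by
    rw [← Real.exp_add]; simp
  have h3 := Real.exp_pos (x^2*((1-r)/(1+r)))
  have h4 : gen1 x r * (Real.sqrt (1-r^2) * Real.exp (x^2*((1-r)/(1+r)))) = (Real.sqrt Real.pi)⁻¹ := by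
    rw [gen1]
    have : (Real.sqrt (1-r^2))⁻¹ * Real.sqrt (1-r^2) = 1 := inv_mul_cancel₀ hs.ne'
    linear_combination (Real.sqrt Real.pi)⁻¹ * ((Real.sqrt (1-r^2))⁻¹ * Real.sqrt (1-r^2)) * h2 + (Real.sqrt Real.pi)⁻¹ * this
  rw [← h4] at h
  exact le_of_mul_le_mul_right h (by positivity)

lemma chernoff1 (K : ℕ) (x r : ℝ) (hr0 : 0 ≤ r) (hr1 : r < 1) :
    ∑ k ∈ Finset.range K, ha k x * r^k ≤ gen1 x r := by
  obtain ⟨M, hM⟩ := exists_nat_ge (2*x^2)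
  refine le_trans ?_ (chernoff1_aux (max K M) x r (hM.trans (by exact_mod_cast le_max_right _ _)) hr0 hr1)
  apply Finset.sum_le_sum_of_subset_of_nonneg
  · intro k hk
    simp only [Finset.mem_range] at *
    have := le_max_left K M
    omega
  · intro k _ _
    have := ha_nonneg k x
    positivity

lemma sum_tuple_succ {M : Type*} [AddCommMonoid M] (d n : ℕ) (f : (Fin (d+1) → ℕ) → M) :
    ∑ i ∈ Finset.Nat.antidiagonalTuple (d+1) n, f i =
    ∑ p ∈ Finset.HasAntidiagonal.antidiagonal n, ∑ j ∈ Finset.Nat.antidiagonalTuple d p.2, f (Fin.cons p.1 j) := by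
  rw [Finset.sum_sigma']
  refine Finset.sum_bij' (fun i _ => ⟨(i 0, ∑ k, i (Fin.succ k)), Fin.tail i⟩)
    (fun q _ => Fin.cons q.1.1 q.2) ?_ ?_ ?_ ?_ ?_
  · intro i hi
    rw [Finset.Nat.mem_antidiagonalTuple, Fin.sum_univ_succ] at hi
    simp only [Finset.mem_sigma, Finset.HasAntidiagonal.mem_antidiagonal, Finset.Nat.mem_antidiagonalTuple]
    exact ⟨hi, rfl⟩
  · rintro ⟨⟨a, b⟩, j⟩ h
    simp only [Finset.mem_sigma, Finset.HasAntidiagonal.mem_antidiagonal, Finset.Nat.mem_antidiagonalTuple] at h ⊢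
    rw [Fin.sum_univ_succ]
    simp [h.2, h.1]
  · intro i _
    simp
  · rintro ⟨⟨a, b⟩, j⟩ h
    simp only [Finset.mem_sigma, Finset.HasAntidiagonal.mem_antidiagonal, Finset.Nat.mem_antidiagonalTuple] at h
    simp [h.2]
  · intro i _
    simp

lemma eSpec_nonneg (d n : ℕ) (x : Fin d → ℝ) : 0 ≤ eSpec d n x :=
  Finset.sum_nonneg fun _ _ => Finset.prod_nonneg fun _ _ => sq_nonneg _

lemma eSpec_succ (d n : ℕ) (x : Fin (d+1) → ℝ) : eSpec (d+1) n x =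
    ∑ p ∈ Finset.HasAntidiagonal.antidiagonal n, ha p.1 (x 0) * eSpec d p.2 (Fin.tail x) := by
  rw [eSpec, sum_tuple_succ]
  refine Finset.sum_congr rfl fun p _ => ?_
  rw [eSpec, Finset.mul_sum]
  refine Finset.sum_congr rfl fun j _ => ?_
  rw [Fin.prod_univ_succ]
  simp [ha, Fin.tail]

lemma eSpec_zero (n : ℕ) (x : Fin 0 → ℝ) : eSpec 0 n x = if n = 0 then 1 else 0 := by
  cases n with
  | zero => simp [eSpec]
  | succ n => simp [eSpec]

lemma conv_trunc_le (a b : ℕ → ℝ) (ha : ∀ n, 0 ≤ a n) (hb : ∀ n, 0 ≤ b n) (K : ℕ) (r : ℝ) (hr : 0 ≤ r) :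
    ∑ k ∈ Finset.range K, (∑ p ∈ Finset.HasAntidiagonal.antidiagonal k, a p.1 * b p.2) * r^k ≤
    (∑ k ∈ Finset.range K, a k * r^k) * (∑ k ∈ Finset.range K, b k * r^k) := by
  rw [Finset.sum_mul_sum, ← Finset.sum_product']
  have : ∑ k ∈ Finset.range K, (∑ p ∈ Finset.HasAntidiagonal.antidiagonal k, a p.1 * b p.2) * r^k
     = ∑ q ∈ (Finset.range K).sigma (fun k => Finset.HasAntidiagonal.antidiagonal k), (a q.2.1 * r^q.2.1) * (b q.2.2 * r^q.2.2) := by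
    rw [Finset.sum_sigma]
    refine Finset.sum_congr rfl fun k _ => ?_
    rw [Finset.sum_mul]
    refine Finset.sum_congr rfl fun p hp => ?_
    rw [Finset.HasAntidiagonal.mem_antidiagonal] at hp
    rw [← hp, pow_add]; ring
  rw [this]
  rw [← Finset.sum_image (g := fun q : (Σ _ : ℕ, ℕ × ℕ) => q.2)
    (f := fun p : ℕ × ℕ => (a p.1 * r^p.1) * (b p.2 * r^p.2))]
  · apply Finset.sum_le_sum_of_subset_of_nonneg
    · intro p hp
      simp only [Finset.mem_image, Finset.mem_sigma, Finset.mem_range, Finset.HasAntidiagonal.mem_antidiagonal] at hp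
      obtain ⟨⟨k, q⟩, ⟨h1, h2⟩, rfl⟩ := hp
      simp only [Finset.mem_product, Finset.mem_range]
      simp only at h1 h2
      omega
    · intro p _ _
      have := ha p.1
      have := hb p.2
      positivity
  · rintro ⟨k, p⟩ h1 ⟨k', p'⟩ h2 h
    simp only [Finset.coe_sigma, Set.mem_sigma_iff, Finset.mem_coe, Finset.HasAntidiagonal.mem_antidiagonal] at h1 h2
    simp only at h
    subst h
    have : k = k' := by rw [← h1.2, ← h2.2]
    subst this; rfl

lemma chernoffd (d K : ℕ) (x : Fin d → ℝ) (r : ℝ) (hr0 : 0 ≤ r) (hr1 : r < 1) :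
    ∑ k ∈ Finset.range K, eSpec d k x * r^k ≤ ∏ i, gen1 (x i) r := by
  induction d with
  | zero =>
    simp only [eSpec_zero, Finset.univ_eq_empty, Finset.prod_empty]
    calc _ ≤ ∑ k ∈ Finset.range (K+1), (if k = 0 then (1:ℝ) else 0) * r^k := by
            apply Finset.sum_le_sum_of_subset_of_nonneg
            · intro k; simp; omega
            · intro k _ _; split_ifs <;> positivity
      _ ≤ 1 := by simp [Finset.sum_range_succ']
  | succ d ih =>
    simp only [eSpec_succ]
    refine (conv_trunc_le (fun n => ha n (x 0)) (fun n => eSpec d n (Fin.tail x)) (fun n => ha_nonneg n _) (fun n => eSpec_nonneg _ _ _) K r hr0).trans ?_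
    rw [Fin.prod_univ_succ]
    have h1 := chernoff1 K (x 0) r hr0 hr1
    have h2 := ih (Fin.tail x)
    have h3 : 0 ≤ gen1 (x 0) r := by rw [gen1]; positivity
    refine mul_le_mul h1 h2 (Finset.sum_nonneg fun k _ => ?_) h3
    have := eSpec_nonneg d k (Fin.tail x)
    positivity

noncomputable def e2 (n : ℕ) (a b : ℝ) : ℝ := ∑ p ∈ Finset.HasAntidiagonal.antidiagonal n, ha p.1 a * ha p.2 b

lemma e2_nonneg (n : ℕ) (a b : ℝ) : 0 ≤ e2 n a b :=
  Finset.sum_nonneg fun _ _ => mul_nonneg (ha_nonneg _ _) (ha_nonneg _ _)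

lemma eSpec_succ_succ (d n : ℕ) (x : Fin (d+2) → ℝ) : eSpec (d+2) n x =
    ∑ p ∈ Finset.HasAntidiagonal.antidiagonal n, e2 p.1 (x 0) (x 1) * eSpec d p.2 (Fin.tail (Fin.tail x)) := by
  have h1 : PowerSeries.mk (fun n => eSpec (d+2) n x) =
      PowerSeries.mk (fun n => ha n (x 0)) * (PowerSeries.mk (fun n => ha n (x 1)) *
        PowerSeries.mk (fun n => eSpec d n (Fin.tail (Fin.tail x)))) := by
    ext n
    rw [PowerSeries.coeff_mul, PowerSeries.coeff_mk, eSpec_succ]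
    refine Finset.sum_congr rfl fun p _ => ?_
    rw [PowerSeries.coeff_mul, PowerSeries.coeff_mk, eSpec_succ]
    simp only [PowerSeries.coeff_mk]
    rfl
  have h2 : PowerSeries.mk (fun n => e2 n (x 0) (x 1)) =
      PowerSeries.mk (fun n => ha n (x 0)) * PowerSeries.mk (fun n => ha n (x 1)) := by
    ext n
    rw [PowerSeries.coeff_mul, PowerSeries.coeff_mk, e2]
    simp only [PowerSeries.coeff_mk]
  rw [← mul_assoc, ← h2] at h1
  have := congrArg (PowerSeries.coeff n) h1
  rw [PowerSeries.coeff_mul, PowerSeries.coeff_mk] at this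
  simpa only [PowerSeries.coeff_mk] using this

open PowerSeries in
lemma ps_ode1 (x : ℝ) : (1 - X) * (1 + X)^2 * PowerSeries.derivative ℝ (PowerSeries.mk (fun n => ha n x)) =
    (X * (1 + X) + C (2*x^2) * (1 - X)) * PowerSeries.mk (fun n => ha n x) := by
  set A : PowerSeries ℝ := PowerSeries.mk (fun n => ha n x) with hA
  set D := PowerSeries.derivative ℝ A with hD
  have hDn : ∀ n, coeff n D = ha (n+1) x * (n+1) := by
    intro n; rw [hD, PowerSeries.coeff_derivative, hA, coeff_mk]
  have hAn : ∀ n, coeff n A = ha n x := by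
    intro n; rw [hA, coeff_mk]
  suffices h : D + D * X - D * X * X - D * X * X * X = A * X + A * X * X + C (2*x^2) * A - C (2*x^2) * (A * X) by
    linear_combination h
  ext n
  rcases n with _ | _ | _ | n
  · simp only [map_add, map_sub, coeff_zero_mul_X, coeff_C_mul, hDn, hAn]
    linear_combination ha_one x
  · simp only [map_add, map_sub, coeff_zero_mul_X, coeff_succ_mul_X, coeff_C_mul, hDn, hAn]
    push_cast
    linear_combination ha_two x
  · simp only [map_add, map_sub, coeff_zero_mul_X, coeff_succ_mul_X, coeff_C_mul, hDn, hAn]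
    have := ha_rec 0 x
    push_cast at *
    simp only [zero_add, Nat.reduceAdd] at *
    linear_combination this
  · simp only [map_add, map_sub, coeff_succ_mul_X, coeff_C_mul, hDn, hAn]
    have := ha_rec (n+1) x
    push_cast at *
    simp only [add_assoc, Nat.reduceAdd] at *
    linear_combination this

noncomputable def ell : ℕ → ℝ → ℝ
  | 0, y => Real.exp (-y/2)
  | 1, y => (y - 1) * Real.exp (-y/2)
  | (k+2), y => ((y - 2*k - 3) * ell (k+1) y - (k+1) * ell k y) / (k+2)

lemma ell_rec (k : ℕ) (y : ℝ) : (k+2) * ell (k+2) y = (y - 2*k - 3) * ell (k+1) y - (k+1) * ell k y := by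
  rw [ell]
  have : (k:ℝ)+2 ≠ 0 := by positivity
  field_simp

open PowerSeries in
lemma e2_eq (n : ℕ) (a b : ℝ) : Real.pi * e2 n a b = ∑ k ∈ Finset.range (n+1), ell k (2*(a^2+b^2)) := by
  set A : PowerSeries ℝ := PowerSeries.mk (fun n => ha n a) with hA
  set B : PowerSeries ℝ := PowerSeries.mk (fun n => ha n b) with hB
  have hAB : ∀ n, coeff n (A * B) = e2 n a b := by
    intro n
    rw [PowerSeries.coeff_mul, e2]
    simp only [hA, hB, PowerSeries.coeff_mk]
  set Λ : PowerSeries ℝ := (1 - X) * (A * B) with hΛ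
  have oA := ps_ode1 a
  have oB := ps_ode1 b
  rw [← hA] at oA
  rw [← hB] at oB
  set y := 2*(a^2+b^2) with hy
  have hne : (1 - X : PowerSeries ℝ) ≠ 0 := by
    intro h
    have := congrArg (coeff 0) h
    simp at this
  have hode : (1+X)^2 * PowerSeries.derivative ℝ Λ = (C y - 1 - X) * Λ := by
    apply mul_left_cancel₀ hne
    have hd : PowerSeries.derivative ℝ Λ = (1 - X) * (A * PowerSeries.derivative ℝ B + B * PowerSeries.derivative ℝ A) - A * B := by
      rw [hΛ, Derivation.leibniz, Derivation.leibniz]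
      simp only [smul_eq_mul, map_sub, derivative_one, derivative_X]
      ring
    have hC : (C y : PowerSeries ℝ) = C (2*a^2) + C (2*b^2) := by
      rw [← map_add, hy]; congr 1; ring
    rw [hd, hΛ, hC]
    linear_combination (1 - X) * B * oA + (1 - X) * A * oB
  have hl0 : coeff 0 Λ * Real.pi = ell 0 y := by
    rw [hΛ, show (1 - X) * (A*B) = A*B - A*B*X by ring, map_sub, coeff_zero_mul_X, hAB]
    simp only [e2, Finset.Nat.antidiagonal_zero, Finset.sum_singleton, ha_zero, ell]
    have h1 : Real.exp (-a^2) * Real.exp (-b^2) = Real.exp (-y/2) := by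
      rw [← Real.exp_add, hy]; congr 1; ring
    have h2 : Real.sqrt Real.pi * Real.sqrt Real.pi = Real.pi := Real.mul_self_sqrt Real.pi_pos.le
    rw [sub_zero, div_mul_div_comm, h1, h2]
    field_simp
  have hode' : ∀ n, coeff n (PowerSeries.derivative ℝ Λ + 2 * (PowerSeries.derivative ℝ Λ * X) + PowerSeries.derivative ℝ Λ * X * X)
     = coeff n (C y * Λ - Λ - Λ * X) := by
    intro n; congr 1; linear_combination hode
  have h2c : (2 : PowerSeries ℝ) = C 2 := (map_ofNat (C : ℝ →+* PowerSeries ℝ) 2).symm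
  have hl1 : coeff 1 Λ * Real.pi = ell 1 y := by
    have := hode' 0
    simp only [map_add, map_sub, h2c, coeff_C_mul, coeff_zero_mul_X, coeff_derivative] at this
    have e : ell 1 y = (y-1) * ell 0 y := by simp [ell]
    rw [e, ← hl0]
    norm_num at this ⊢
    linear_combination Real.pi * this
  have hl : ∀ k, coeff k Λ * Real.pi = ell k y ∧ coeff (k+1) Λ * Real.pi = ell (k+1) y := by
    intro k
    induction k with
    | zero => exact ⟨hl0, hl1⟩
    | succ k ih =>
      refine ⟨ih.2, ?_⟩
      have hk : (k:ℝ)+2 ≠ 0 := by positivity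
      apply mul_left_cancel₀ hk
      rw [ell_rec, ← ih.1, ← ih.2]
      have := hode' (k+1)
      cases k with
      | zero =>
        simp only [map_add, map_sub, h2c, coeff_C_mul, coeff_zero_mul_X, coeff_succ_mul_X, coeff_derivative] at this
        push_cast at *
        simp only [zero_add, Nat.reduceAdd] at *
        linear_combination Real.pi * this
      | succ k =>
        simp only [map_add, map_sub, h2c, coeff_C_mul, coeff_zero_mul_X, coeff_succ_mul_X, coeff_derivative] at this
        push_cast at *
        simp only [add_assoc, Nat.reduceAdd] at *
        linear_combination Real.pi * this
  induction n with
  | zero =>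
    rw [← hAB, Finset.sum_range_one, ← hl0, hΛ, show (1 - X) * (A*B) = A*B - A*B*X by ring, map_sub, coeff_zero_mul_X]
    ring
  | succ n ih =>
    rw [Finset.sum_range_succ, ← ih, ← (hl (n+1)).1, hΛ, show (1 - X) * (A*B) = A*B - A*B*X by ring, map_sub, coeff_succ_mul_X, hAB, hAB]
    ring

noncomputable def FF (n : ℕ) (y : ℝ) : ℝ := ∑ k ∈ Finset.range (n+1), ell k y

lemma FF_eq (n : ℕ) (y : ℝ) (hy : 0 ≤ y) : FF n y = Real.pi * e2 n (Real.sqrt (y/2)) 0 := by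
  rw [e2_eq, FF, Real.sq_sqrt (by positivity)]
  congr 1; funext k; congr 1; ring

lemma FF_nonneg (n : ℕ) (y : ℝ) (hy : 0 ≤ y) : 0 ≤ FF n y := by
  rw [FF_eq n y hy]
  exact mul_nonneg Real.pi_pos.le (e2_nonneg _ _ _)

lemma chernoffF (K : ℕ) (y r : ℝ) (hy : 0 ≤ y) (hr0 : 0 ≤ r) (hr1 : r < 1) :
    ∑ k ∈ Finset.range K, FF k y * r^k ≤ (1-r^2)⁻¹ * Real.exp (-(y/2)*((1-r)/(1+r))) := by
  have h1 := conv_trunc_le (fun n => ha n (Real.sqrt (y/2))) (fun n => ha n 0) (fun n => ha_nonneg _ _)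
    (fun n => ha_nonneg _ _) K r hr0
  have h2 := chernoff1 K (Real.sqrt (y/2)) r hr0 hr1
  have h3 := chernoff1 K 0 r hr0 hr1
  have h4 : 0 ≤ gen1 (Real.sqrt (y/2)) r := by rw [gen1]; positivity
  have h5 : 0 ≤ ∑ k ∈ Finset.range K, ha k 0 * r^k :=
    Finset.sum_nonneg fun k _ => by have := ha_nonneg k 0; positivity
  have h6 := h1.trans (mul_le_mul h2 h3 h5 h4)
  have h7 : ∑ k ∈ Finset.range K, FF k y * r^k = Real.pi * ∑ k ∈ Finset.range K, (∑ p ∈ Finset.HasAntidiagonal.antidiagonal k, ha p.1 (Real.sqrt (y/2)) * ha p.2 0) * r^k := by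
    rw [Finset.mul_sum]
    refine Finset.sum_congr rfl fun k _ => ?_
    rw [FF_eq k y hy, e2]; ring
  rw [h7]
  refine (mul_le_mul_of_nonneg_left h6 Real.pi_pos.le).trans (le_of_eq ?_)
  rw [gen1, gen1, Real.sq_sqrt (by positivity)]
  have hp : 0 < 1 - r^2 := by nlinarith
  have e1 : (Real.sqrt Real.pi)⁻¹ * (Real.sqrt Real.pi)⁻¹ = Real.pi⁻¹ := by
    rw [← mul_inv, Real.mul_self_sqrt Real.pi_pos.le]
  have e2 : (Real.sqrt (1-r^2))⁻¹ * (Real.sqrt (1-r^2))⁻¹ = (1-r^2)⁻¹ := by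
    rw [← mul_inv, Real.mul_self_sqrt hp.le]
  have e3 : Real.pi * Real.pi⁻¹ = 1 := mul_inv_cancel₀ Real.pi_ne_zero
  simp only [ne_eq, OfNat.ofNat_ne_zero, not_false_eq_true, zero_pow, neg_zero, zero_mul, Real.exp_zero, mul_one]
  set s := (Real.sqrt Real.pi)⁻¹
  set t := (Real.sqrt (1-r^2))⁻¹
  set E := Real.exp (-(y/2)*((1-r)/(1+r)))
  linear_combination Real.pi * t * t * E * e1 + t * t * E * e3 + E * e2

structure Sys (N b A : ℝ) (F v w : ℝ → ℝ) : Prop where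
  hb : 1 ≤ b
  hN : b^3 = N
  hA : 0 ≤ A
  hF : ∀ y, 0 < y → HasDerivAt F (v y / y) y
  hv : ∀ y, 0 < y → HasDerivAt v (w y) y
  hw : ∀ y, 0 < y → HasDerivAt w (-((N - y/4)/y * v y)) y
  Fnn : ∀ y, 0 ≤ y → 0 ≤ F y
  Wnn : ∀ y, 0 ≤ y → 0 ≤ w y + (N - y/4) * F y
  Wle : ∀ y, 0 ≤ y → w y + (N - y/4) * F y ≤ A * max (N - y/4) b
  vlim : Filter.Tendsto v Filter.atTop (nhds 0)
  v0 : v 0 = 0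
  vd : DifferentiableAt ℝ v 0
  wc : ContinuousAt w 0
  w0 : (w 0)^2 ≤ (N/2)^2

namespace Sys
variable {N b A : ℝ} {F v w : ℝ → ℝ}

lemma bN (S : Sys N b A F v w) : b ≤ N := by
  have := S.hb
  rw [← S.hN]; nlinarith [sq_nonneg b, sq_nonneg (b-1)]

lemma N1 (S : Sys N b A F v w) : 1 ≤ N := S.hb.trans S.bN

/-- monotonicity helper -/
lemma mono_of_deriv {f f' : ℝ → ℝ} {s : Set ℝ} (hs : Convex ℝ s) (hf : ∀ y ∈ s, HasDerivAt f (f' y) y)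
    (h : ∀ y ∈ s, 0 ≤ f' y) : MonotoneOn f s := by
  apply monotoneOn_of_deriv_nonneg hs
  · exact fun y hy => (hf y hy).continuousAt.continuousWithinAt
  · exact fun y hy => (hf y (interior_subset hy)).differentiableAt.differentiableWithinAt
  · intro y hy
    rw [(hf y (interior_subset hy)).deriv]
    exact h y (interior_subset hy)

lemma anti_of_deriv {f f' : ℝ → ℝ} {s : Set ℝ} (hs : Convex ℝ s) (hf : ∀ y ∈ s, HasDerivAt f (f' y) y)
    (h : ∀ y ∈ s, f' y ≤ 0) : AntitoneOn f s := by
  have := mono_of_deriv (f := fun y => - f y) (f' := fun y => - f' y) hs (fun y hy => (hf y hy).neg)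
    (fun y hy => by linarith [h y hy])
  intro x hx y hy hxy
  have := this hx hy hxy
  simp only at this
  linarith

lemma hW (S : Sys N b A F v w) (y : ℝ) (hy : 0 < y) :
    HasDerivAt (fun y => w y + (N - y/4) * F y) (-(F y)/4) y := by
  have h1 : HasDerivAt (fun y : ℝ => N - y/4) (-(1/4)) y := by
    simpa using ((hasDerivAt_id y).div_const 4).const_sub N
  have := (S.hw y hy).add (h1.mul (S.hF y hy))
  refine this.congr_deriv ?_
  field_simp
  ring

/-- zone 1: bound on w -/
lemma w_bound (S : Sys N b A F v w) (y : ℝ) (hy : 0 ≤ y) (hy4 : y < 4*N) : (w y)^2 ≤ (N/2)^2 := by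
  rcases hy.eq_or_lt with rfl | hy
  · exact S.w0
  have hN1 := S.N1
  set E : ℝ → ℝ := fun y => (N - y/4) / y * (v y)^2 + (w y)^2 with hE
  have hEd : ∀ y ∈ Set.Ioo 0 (4*N), HasDerivAt E (-(N/y^2) * (v y)^2) y := by
    intro y hy
    have hy0 := hy.1
    have h1 : HasDerivAt (fun y : ℝ => N - y/4) (-(1/4)) y := by
      simpa using ((hasDerivAt_id y).div_const 4).const_sub N
    have h2 := ((h1.div (hasDerivAt_id y) hy0.ne').mul ((S.hv y hy0).pow 2)).add ((S.hw y hy0).pow 2)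
    refine h2.congr_deriv ?_
    simp
    field_simp
    ring
  have hanti := anti_of_deriv (convex_Ioo 0 (4*N)) hEd (by
    intro y hy
    have : 0 ≤ N/y^2 * (v y)^2 := by have := hy.1; positivity
    linarith)
  have hlim : Filter.Tendsto E (nhdsWithin 0 (Set.Ioi 0)) (nhds ((w 0)^2)) := by
    have t1 : Filter.Tendsto (fun y => v y / y) (nhdsWithin 0 (Set.Ioi 0)) (nhds (deriv v 0)) := by
      have := (S.vd.hasDerivAt.tendsto_slope)
      have h2 := this.mono_left (nhdsWithin_mono 0 (show Set.Ioi (0:ℝ) ⊆ {0}ᶜ from fun y hy => ne_of_gt hy))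
      refine h2.congr fun y => ?_
      simp [slope_def_field, S.v0]
    have t2 : Filter.Tendsto v (nhdsWithin 0 (Set.Ioi 0)) (nhds 0) := by
      have := S.vd.continuousAt.tendsto
      rw [S.v0] at this
      exact this.mono_left nhdsWithin_le_nhds
    have t3 : Filter.Tendsto w (nhdsWithin 0 (Set.Ioi 0)) (nhds (w 0)) :=
      S.wc.tendsto.mono_left nhdsWithin_le_nhds
    have t4 : Filter.Tendsto (fun y : ℝ => N - y/4) (nhdsWithin 0 (Set.Ioi 0)) (nhds (N - 0/4)) := by
      have : Continuous (fun y : ℝ => N - y/4) := by fun_prop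
      exact this.continuousAt.tendsto.mono_left nhdsWithin_le_nhds
    have := ((t4.mul (t1.mul t2)).add (t3.pow 2))
    simp only [mul_zero, zero_add] at this
    refine this.congr fun y => ?_
    simp only [hE]
    ring
  have hle : E y ≤ (w 0)^2 := by
    refine ge_of_tendsto hlim ?_
    have : Set.Ioo 0 y ∈ nhdsWithin (0:ℝ) (Set.Ioi 0) := Ioo_mem_nhdsGT hy
    filter_upwards [this] with z hz
    exact hanti ⟨hz.1, hz.2.trans hy4⟩ ⟨hy, hy4⟩ hz.2.le
  have hpos : 0 ≤ (N - y/4) / y * (v y)^2 := by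
    have : 0 ≤ N - y/4 := by linarith
    positivity
  have := S.w0
  simp only [hE] at hle
  linarith

lemma zone1 (S : Sys N b A F v w) (y : ℝ) (hy : 0 ≤ y) (hy4 : y ≤ 3*N) : F y ≤ 4*A+2 := by
  have hN1 := S.N1
  have hA := S.hA
  have h1 := abs_le_of_sq_le_sq (S.w_bound y hy (by linarith)) (by linarith)
  have h2 := S.Wle y hy
  have h3 : max (N - y/4) b ≤ N := max_le (by linarith) S.bN
  have h4 : A * max (N - y/4) b ≤ A * N := mul_le_mul_of_nonneg_left h3 hA
  have h5 := S.Fnn y hy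
  have h6 : N/4 * F y ≤ (N - y/4) * F y := mul_le_mul_of_nonneg_right (by linarith) h5
  have h7 : N * F y ≤ N * (4*A+2) := by linarith [(abs_le.mp h1).1]
  exact le_of_mul_le_mul_left h7 (by linarith)

lemma v_mono (S : Sys N b A F v w) : MonotoneOn v (Set.Ici (4*N)) := by
  have hN1 := S.N1
  refine mono_of_deriv (convex_Ici _) (fun y hy => S.hv y ?_) ?_
  · have : 4*N ≤ y := hy
    linarith
  · intro y hy
    have hy' : 4*N ≤ y := hy
    have h1 := S.Wnn y (by linarith)
    have h2 := S.Fnn y (by linarith)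
    nlinarith

lemma v_nonpos (S : Sys N b A F v w) (y : ℝ) (hy : 4*N ≤ y) : v y ≤ 0 := by
  refine ge_of_tendsto S.vlim ?_
  filter_upwards [Filter.eventually_ge_atTop y] with z hz
  exact S.v_mono hy (show 4*N ≤ z by linarith) hz

lemma F_anti (S : Sys N b A F v w) : AntitoneOn F (Set.Ici (4*N)) := by
  have hN1 := S.N1
  refine anti_of_deriv (convex_Ici _) (fun y hy => S.hF y ?_) ?_
  · have : 4*N ≤ y := hy
    linarith
  · intro y hy
    have hy' : 4*N ≤ y := hy
    exact div_nonpos_of_nonpos_of_nonneg (S.v_nonpos y hy) (by linarith)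

lemma F_edge (S : Sys N b A F v w) : F (4*N+b) ≤ 4*A := by
  have hN1 := S.N1
  have hb := S.hb
  set W := fun y => w y + (N - y/4) * F y with hWdef
  obtain ⟨c, hc, hc'⟩ := exists_hasDerivAt_eq_slope W (fun y => -(F y)/4) (show 4*N < 4*N+b by linarith)
    (fun y hy => (S.hW y (by linarith [hy.1])).continuousAt.continuousWithinAt)
    (fun y hy => S.hW y (by linarith [hy.1]))
  have h1 : F (4*N+b) ≤ F c := S.F_anti (show 4*N ≤ c from hc.1.le) (show 4*N ≤ 4*N+b by linarith) hc.2.le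
  have h2 : W (4*N) ≤ A * b := by
    have := S.Wle (4*N) (by linarith)
    have e : max (N - 4*N/4) b = b := max_eq_right (by linarith)
    rwa [e] at this
  have h3 : 0 ≤ W (4*N+b) := S.Wnn _ (by linarith)
  rw [eq_div_iff (by linarith)] at hc'
  have h4 : b * F (4*N+b) ≤ b * (4*A) := by nlinarith
  exact le_of_mul_le_mul_left h4 (by linarith)

lemma v_edge (S : Sys N b A F v w) : (v (4*N+2*b))^2 ≤ (24*A*b^2)^2 := by
  have hN1 := S.N1
  have hb := S.hb
  have hbN := S.bN
  have hA := S.hA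
  obtain ⟨c, hc, hc'⟩ := exists_hasDerivAt_eq_slope F (fun y => v y / y) (show 4*N+b < 4*N+2*b by linarith)
    (fun y hy => (S.hF y (by linarith [hy.1])).continuousAt.continuousWithinAt)
    (fun y hy => S.hF y (by linarith [hy.1]))
  have h1 : v c ≤ v (4*N+2*b) := S.v_mono (show 4*N ≤ c by linarith [hc.1]) (show 4*N ≤ 4*N+2*b by linarith) hc.2.le
  have h2 := S.v_nonpos (4*N+2*b) (by linarith)
  have h3 := S.F_edge
  have h4 := S.Fnn (4*N+2*b) (by linarith)
  have hc0 : 0 < c := by linarith [hc.1]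
  have hb0 : 0 < b := by linarith
  rw [div_eq_div_iff hc0.ne' (by linarith)] at hc'
  have h5 : b * (-(v (4*N+2*b))) ≤ b * (24*A*b^2) := by
    have : 4*A*c ≤ 4*A*(6*N) := mul_le_mul_of_nonneg_left (by linarith [hc.2]) (by linarith)
    have h6 : (F (4*N+b) - F (4*N+2*b)) * c ≤ 4*A*c := mul_le_mul_of_nonneg_right (by linarith) hc0.le
    have h7 := S.hN
    nlinarith
  have h6 := le_of_mul_le_mul_left h5 hb0
  nlinarith

lemma w_edge (S : Sys N b A F v w) : (w (4*N+2*b))^2 ≤ (3*A*b)^2 := by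
  have hN1 := S.N1
  have hb := S.hb
  have hA := S.hA
  have h1 := S.Wle (4*N+2*b) (by linarith)
  have h0 := S.Wnn (4*N+2*b) (by linarith)
  rw [max_eq_right (by linarith)] at h1
  have h2 : F (4*N+2*b) ≤ 4*A :=
    (S.F_anti (show 4*N ≤ 4*N+b by linarith) (show 4*N ≤ 4*N+2*b by linarith) (by linarith)).trans S.F_edge
  have h3 := S.Fnn (4*N+2*b) (by linarith)
  have h4 : w (4*N+2*b) ≤ 3*A*b := by nlinarith
  have h5 : 0 ≤ w (4*N+2*b) := by nlinarith
  exact pow_le_pow_left₀ h5 h4 2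

lemma window (S : Sys N b A F v w) (y : ℝ) (hy1 : 4*N - b ≤ y) (hy2 : y ≤ 4*N+2*b) :
    (v y)^2/b^4 + (w y)^2/b^2 ≤ Real.exp 6 * (585*A^2) := by
  have hN1 := S.N1
  have hb := S.hb
  have hbN := S.bN
  have hA := S.hA
  have hb0 : 0 < b := by linarith
  set E : ℝ → ℝ := fun y => Real.exp (2/b*y) * ((v y)^2/b^4 + (w y)^2/b^2) with hE
  have hd : ∀ y ∈ Set.Icc (4*N-b) (4*N+2*b), HasDerivAt E (Real.exp (2/b*y) *
      (2/b * ((v y)^2/b^4 + (w y)^2/b^2) + (2 * v y * w y / b^4 - 2 * w y * ((N - y/4)/y * v y)/b^2))) y := by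
    intro y hy
    have hy0 : 0 < y := by linarith [hy.1]
    have h1 : HasDerivAt (fun y : ℝ => Real.exp (2/b*y)) (Real.exp (2/b*y) * (2/b)) y := by
      simpa using ((hasDerivAt_id y).const_mul (2/b)).exp
    have h2 := h1.mul ((((S.hv y hy0).pow 2).div_const (b^4)).add (((S.hw y hy0).pow 2).div_const (b^2)))
    refine h2.congr_deriv ?_
    simp
    ring
  have hm := mono_of_deriv (convex_Icc _ _) hd (by
    intro y hy
    have hy0 : 0 < y := by linarith [hy.1]
    refine mul_nonneg (Real.exp_pos _).le ?_
    set q := (N - y/4)/y with hq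
    have hq1 : |q| ≤ 1/b^2 := by
      rw [hq, abs_div, abs_of_pos hy0, div_le_div_iff₀ hy0 (by positivity)]
      have a1 : |N - y/4| ≤ b/2 := by
        rw [abs_le]; constructor <;> linarith [hy.1, hy.2]
      have : |N - y/4| * b^2 ≤ b/2*b^2 := mul_le_mul_of_nonneg_right a1 (by positivity)
      have := S.hN
      nlinarith [hy.1]
    set V := v y / b^2 with hV
    set U := w y / b with hU
    have e : 2/b * ((v y)^2/b^4 + (w y)^2/b^2) + (2 * v y * w y / b^4 - 2 * w y * (q * v y)/b^2)
       = 2/b * (V^2 + U^2 + V*U*(1 - q*b^2)) := by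
      rw [hV, hU]; field_simp
    rw [e]
    have hq2 : |1 - q*b^2| ≤ 2 := by
      have : |q| * b^2 ≤ 1 := by
        rw [le_div_iff₀ (by positivity)] at hq1; exact hq1
      have h3 : |q*b^2| ≤ 1 := by rwa [abs_mul, abs_of_pos (show 0 < b^2 by positivity)]
      rw [abs_le] at h3 ⊢
      constructor <;> linarith [h3.1, h3.2]
    have : 0 ≤ V^2 + U^2 + V*U*(1 - q*b^2) := by
      have h5 : |V*U*(1-q*b^2)| ≤ |V| * |U| * 2 := by
        rw [abs_mul, abs_mul]
        exact mul_le_mul_of_nonneg_left hq2 (by positivity)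
      have := neg_abs_le (V*U*(1-q*b^2))
      nlinarith [sq_nonneg (|V| - |U|), sq_abs V, sq_abs U]
    positivity)
  have h := hm (Set.mem_Icc.mpr ⟨hy1, hy2⟩) (Set.mem_Icc.mpr ⟨by linarith, le_refl _⟩) hy2
  simp only [hE] at h
  have hv := S.v_edge
  have hw := S.w_edge
  have h3 : (v (4*N+2*b))^2/b^4 + (w (4*N+2*b))^2/b^2 ≤ 585*A^2 := by
    have : (v (4*N+2*b))^2/b^4 ≤ 576*A^2 := by
      rw [div_le_iff₀ (by positivity)]; linarith
    have : (w (4*N+2*b))^2/b^2 ≤ 9*A^2 := by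
      rw [div_le_iff₀ (by positivity)]; linarith
    linarith
  have h4 : Real.exp (2/b*(4*N+2*b)) ≤ Real.exp (2/b*y) * Real.exp 6 := by
    rw [← Real.exp_add]
    apply Real.exp_le_exp.mpr
    have : 2/b*(4*N+2*b) - 2/b*y ≤ 2/b*(3*b) := by
      rw [← mul_sub]; exact mul_le_mul_of_nonneg_left (by linarith) (by positivity)
    have e : 2/b*(3*b) = 6 := by field_simp; norm_num
    linarith
  have h5 : Real.exp (2/b*y) * ((v y)^2/b^4 + (w y)^2/b^2) ≤ Real.exp (2/b*y) * (Real.exp 6 * (585*A^2)) := by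
    rw [← mul_assoc]
    exact h.trans (mul_le_mul h4 h3 (by positivity) (by positivity))
  exact le_of_mul_le_mul_left h5 (Real.exp_pos _)

lemma zoneE (S : Sys N b A F v w) (y : ℝ) (hy1 : 4*N - b ≤ y) (hy2 : y ≤ 4*N+b) :
    F y ≤ 4*A + Real.sqrt (Real.exp 6 * (585*A^2)) := by
  have hN1 := S.N1
  have hb := S.hb
  have hbN := S.bN
  have hA := S.hA
  have hb0 : 0 < b := by linarith
  set T := Real.sqrt (Real.exp 6 * (585*A^2)) with hT
  have hT0 : 0 ≤ T := Real.sqrt_nonneg _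
  rcases hy2.eq_or_lt with rfl | hy2
  · linarith [S.F_edge]
  obtain ⟨c, hc, hc'⟩ := exists_hasDerivAt_eq_slope F (fun y => v y / y) hy2
    (fun y hy => (S.hF y (by linarith [hy.1])).continuousAt.continuousWithinAt)
    (fun y hy => S.hF y (by linarith [hy.1]))
  have h1 := S.window c (by linarith [hc.1]) (by linarith [hc.2])
  have h2 : |v c| ≤ T * b^2 := by
    apply abs_le_of_sq_le_sq' _ (by positivity) |> abs_le.mpr
    have : (v c)^2/b^4 ≤ T^2 := by
      rw [hT, Real.sq_sqrt (by positivity)]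
      have : 0 ≤ (w c)^2/b^2 := by positivity
      linarith
    rw [div_le_iff₀ (by positivity)] at this
    linarith
  have hc0 : 0 < c := by linarith [hc.1]
  rw [div_eq_div_iff hc0.ne' (by linarith)] at hc'
  have h3 := S.F_edge
  have h4 : (F y - F (4*N+b)) * c ≤ T * c := by
    have : (F y - F (4*N+b)) * c = - v c * (4*N+b-y) := by linarith
    rw [this]
    have a1 : -v c * (4*N+b-y) ≤ (T*b^2) * (4*N+b-y) :=
      mul_le_mul_of_nonneg_right (by linarith [(abs_le.mp h2).1]) (by linarith)
    have a2 : (T*b^2) * (4*N+b-y) ≤ (T*b^2)*(2*b) := mul_le_mul_of_nonneg_left (by linarith) (by positivity)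
    have a3 : (T*b^2)*(2*b) = T*(2*N) := by rw [← S.hN]; ring
    have a4 : T*(2*N) ≤ T*c := mul_le_mul_of_nonneg_left (by linarith [hc.1]) hT0
    linarith
  have := le_of_mul_le_mul_right h4 hc0
  linarith

lemma zone3 (S : Sys N b A F v w) (y : ℝ) (hy1 : 3*N ≤ y) (hy2 : y ≤ 4*N-b) :
    F y ≤ 4*A + Real.sqrt (24 * (Real.exp 6 * (585*A^2))) := by
  have hN1 := S.N1
  have hb := S.hb
  have hbN := S.bN
  have hA := S.hA
  have hb0 : 0 < b := by linarith
  set T := Real.exp 6 * (585*A^2) with hT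
  have hT0 : 0 ≤ T := by positivity
  set E : ℝ → ℝ := fun y => (v y)^2 + (w y)^2 * (y / (N - y/4)) with hE
  have hd : ∀ y ∈ Set.Icc (3*N) (4*N-b), HasDerivAt E ((w y)^2 * (N / (N-y/4)^2)) y := by
    intro y hy
    have hy0 : 0 < y := by linarith [hy.1]
    have hQ : 0 < N - y/4 := by linarith [hy.2]
    have h1 : HasDerivAt (fun y : ℝ => N - y/4) (-(1/4)) y := by
      simpa using ((hasDerivAt_id y).div_const 4).const_sub N
    have h2 := ((S.hv y hy0).pow 2).add (((S.hw y hy0).pow 2).mul ((hasDerivAt_id y).div h1 hQ.ne'))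
    refine h2.congr_deriv ?_
    simp
    generalize hq : N - y/4 = Q at *
    have : N = Q + y/4 := by linarith
    rw [this]
    field_simp
    ring
  have hm := mono_of_deriv (convex_Icc _ _) hd (by
    intro y hy
    positivity)
  have h := hm (Set.mem_Icc.mpr ⟨hy1, hy2⟩) (Set.mem_Icc.mpr ⟨by linarith, le_refl _⟩) hy2
  simp only [hE] at h
  have hwin := S.window (4*N-b) le_rfl (by linarith)
  rw [← hT] at hwin
  set v1 := v (4*N-b)
  set w1 := w (4*N-b)
  have hv1 : v1^2 ≤ T*b^4 := by
    have : v1^2/b^4 ≤ T := by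
      have : 0 ≤ w1^2/b^2 := by positivity
      linarith
    rwa [div_le_iff₀ (by positivity)] at this
  have hw1 : w1^2 ≤ T*b^2 := by
    have : w1^2/b^2 ≤ T := by
      have : 0 ≤ v1^2/b^4 := by positivity
      linarith
    rwa [div_le_iff₀ (by positivity)] at this
  have hQ : b/4 ≤ N - y/4 := by linarith
  have hq1 : (4*N-b) / (N - (4*N-b)/4) ≤ 16*b^2 := by
    have : N - (4*N-b)/4 = b/4 := by ring
    rw [this, div_le_iff₀ (by positivity), ← S.hN]
    nlinarith
  have h1 : w1^2 * ((4*N-b) / (N - (4*N-b)/4)) ≤ (T*b^2)*(16*b^2) := by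
    refine mul_le_mul hw1 hq1 ?_ (by positivity)
    have : N - (4*N-b)/4 = b/4 := by ring
    rw [this]
    exact div_nonneg (by linarith) (by linarith)
  have h2 : (w y)^2 * (y / (N-y/4)) ≤ 17*T*b^4 := by nlinarith [sq_nonneg (v y)]
  have hQ0 : 0 < N - y/4 := by linarith
  have h3 : (w y)^2 ≤ 24*T*(N-y/4)^2 := by
    rw [← mul_div_assoc, div_le_iff₀ hQ0] at h2
    have a1 : (w y)^2 * (3*N) ≤ (w y)^2 * y := mul_le_mul_of_nonneg_left hy1 (sq_nonneg _)
    have a2 : 17*T*b^4*(N-y/4) ≤ N * (72*T*(N-y/4)^2) := by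
      rw [← S.hN]
      have : b * (T*b^3*(N-y/4)) ≤ (4*(N-y/4)) * (T*b^3*(N-y/4)) :=
        mul_le_mul_of_nonneg_right (by linarith) (by positivity)
      rw [S.hN] at this ⊢
      have e : b^4 = b * N := by rw [← S.hN]; ring
      rw [e]
      have h0 : 0 ≤ N * (T * (N-y/4)^2) := by positivity
      nlinarith
    have a3 : N * (w y)^2 ≤ N * (24*T*(N-y/4)^2) := by linarith
    exact le_of_mul_le_mul_left a3 (by linarith)
  have h4 : |w y| ≤ Real.sqrt (24*T) * (N-y/4) := by
    apply abs_le_of_sq_le_sq' _ (by positivity) |> abs_le.mpr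
    rw [mul_pow, Real.sq_sqrt (by positivity)]
    exact h3
  have h5 := S.Wle y (by linarith)
  have h6 : max (N-y/4) b ≤ 4*(N-y/4) := max_le (by linarith) (by linarith)
  have h7 : A * max (N-y/4) b ≤ A*(4*(N-y/4)) := mul_le_mul_of_nonneg_left h6 hA
  have h8 : (N-y/4) * F y ≤ (N-y/4) * (4*A + Real.sqrt (24*T)) := by
    linarith [(abs_le.mp h4).1]
  exact le_of_mul_le_mul_left h8 hQ0

lemma bound (S : Sys N b A F v w) (y : ℝ) (hy : 0 ≤ y) :
    F y ≤ 4*A + 2 + Real.sqrt (24 * (Real.exp 6 * (585*A^2))) := by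
  have hN1 := S.N1
  have hb := S.hb
  have h0 : 0 ≤ Real.sqrt (24 * (Real.exp 6 * (585*A^2))) := Real.sqrt_nonneg _
  rcases le_total y (3*N) with h1 | h1
  · linarith [S.zone1 y hy h1]
  rcases le_total y (4*N-b) with h2 | h2
  · linarith [S.zone3 y h1 h2]
  have h5 : Real.sqrt (Real.exp 6 * (585*A^2)) ≤ Real.sqrt (24 * (Real.exp 6 * (585*A^2))) := by
    apply Real.sqrt_le_sqrt
    have : 0 ≤ Real.exp 6 * (585*A^2) := by positivity
    linarith
  rcases le_total y (4*N+b) with h3 | h3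
  · linarith [S.zoneE y h2 h3]
  · have := S.F_anti (show 4*N ≤ 4*N+b by linarith) (show 4*N ≤ y by linarith) h3
    linarith [S.F_edge]

end Sys

lemma ell_fun0 : ell 0 = fun y => Real.exp (-y/2) := by funext y; rw [ell]
lemma ell_fun1 : ell 1 = fun y => (y-1) * Real.exp (-y/2) := by funext y; rw [ell]
lemma ell_fun2 (k : ℕ) : ell (k+2) = fun y => ((y - 2*k - 3) * ell (k+1) y - (k+1) * ell k y) / (k+2) := by
  funext y; rw [ell]

lemma ell_diff2 (k : ℕ) : Differentiable ℝ (ell k) ∧ Differentiable ℝ (ell (k+1)) := by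
  induction k with
  | zero =>
    rw [ell_fun0, ell_fun1]
    exact ⟨by fun_prop, by fun_prop⟩
  | succ k ih =>
    refine ⟨ih.2, ?_⟩
    have h1 := ih.1
    have h2 := ih.2
    rw [ell_fun2]
    fun_prop

lemma ell_diff (k : ℕ) : Differentiable ℝ (ell k) := (ell_diff2 k).1

lemma ell0_deriv (y : ℝ) : deriv (ell 0) y = - ell 0 y / 2 := by
  rw [ell_fun0]
  have h : HasDerivAt (fun y : ℝ => -y/2) (-1/2) y := by
    simpa using ((hasDerivAt_id y).neg.div_const 2)
  rw [h.exp.deriv]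
  ring

lemma ell_one (y : ℝ) : ell 1 y = (y-1) * ell 0 y := by simp [ell]

lemma ell1_deriv (y : ℝ) : deriv (ell 1) y = ell 0 y + (y-1) * (- ell 0 y / 2) := by
  have h0 : HasDerivAt (ell 0) (- ell 0 y / 2) y := by
    rw [← ell0_deriv]; exact (ell_diff 0 y).hasDerivAt
  have h : HasDerivAt (fun y : ℝ => y - 1) 1 y := (hasDerivAt_id y).sub_const 1
  have e : ell 1 = fun y => (y-1) * ell 0 y := by funext y; exact ell_one y
  have h3 : HasDerivAt (fun y => (y-1) * ell 0 y) _ y := h.mul h0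
  rw [e, h3.deriv]
  ring

lemma ell_rec_deriv (k : ℕ) (y : ℝ) : (k+2) * deriv (ell (k+2)) y =
    ell (k+1) y + (y - 2*k - 3) * deriv (ell (k+1)) y - (k+1) * deriv (ell k) y := by
  have h0 := (ell_diff k y).hasDerivAt
  have h1 := (ell_diff (k+1) y).hasDerivAt
  have h : HasDerivAt (fun y : ℝ => y - 2*k - 3) 1 y := ((hasDerivAt_id y).sub_const _).sub_const _
  have := ((h.mul h1).sub (h0.const_mul ((k:ℝ)+1)))
  have h2 := ((ell_diff (k+2) y).hasDerivAt).const_mul ((k:ℝ)+2)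
  have e : (fun y => ((k:ℝ)+2) * ell (k+2) y) = fun y => (y - 2*k - 3) * ell (k+1) y - (k+1) * ell k y := by
    funext y; exact ell_rec k y
  rw [e] at h2
  have := h2.unique this
  rw [this]; ring

lemma ell_PR (k : ℕ) (y : ℝ) :
    (y * deriv (ell k) y = (y/2 - k - 1) * ell k y - (k+1) * ell (k+1) y) ∧
    (y * deriv (ell (k+1)) y = (k + 1 - y/2) * ell (k+1) y + (k+1) * ell k y) := by
  induction k with
  | zero =>
    rw [zero_add, ell0_deriv, ell1_deriv, ell_one]
    push_cast
    constructor <;> ring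
  | succ k ih =>
    obtain ⟨R, P⟩ := ih
    have r := ell_rec k y
    have rd := ell_rec_deriv k y
    have hk : (k:ℝ)+2 ≠ 0 := by positivity
    constructor
    · push_cast
      rw [show k+1+1 = k+2 from rfl]
      linear_combination P + r
    · push_cast
      rw [show k+1+1 = k+2 from rfl]
      apply mul_left_cancel₀ hk
      linear_combination y * rd + (y-2*k-3) * P - (k+1) * R - ((k:ℝ)+2-y/2) * r

noncomputable def vv (n : ℕ) (y : ℝ) : ℝ := -((n+1:ℝ)/2) * (ell (n+1) y + ell n y)
noncomputable def ww (n : ℕ) (y : ℝ) : ℝ := ((n+1:ℝ)/4) * (ell (n+1) y - ell n y)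

lemma vv_diff (n : ℕ) : Differentiable ℝ (vv n) := by
  have h1 := ell_diff n
  have h2 := ell_diff (n+1)
  unfold vv
  fun_prop

lemma ww_diff (n : ℕ) : Differentiable ℝ (ww n) := by
  have h1 := ell_diff n
  have h2 := ell_diff (n+1)
  unfold ww
  fun_prop

lemma vv_deriv (n : ℕ) (y : ℝ) (hy : 0 < y) : HasDerivAt (vv n) (ww n y) y := by
  have h := (((ell_diff (n+1) y).hasDerivAt).add ((ell_diff n y).hasDerivAt)).const_mul (-((n+1:ℝ)/2))
  refine h.congr_deriv ?_
  apply mul_left_cancel₀ hy.ne'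
  unfold ww
  obtain ⟨R, P⟩ := ell_PR n y
  linear_combination (-((n+1:ℝ)/2)) * (R + P)

lemma ww_deriv (n : ℕ) (y : ℝ) (hy : 0 < y) :
    HasDerivAt (ww n) (-(((n+1:ℝ) - y/4)/y * vv n y)) y := by
  have h := (((ell_diff (n+1) y).hasDerivAt).sub ((ell_diff n y).hasDerivAt)).const_mul (((n+1:ℝ)/4))
  refine h.congr_deriv ?_
  apply mul_left_cancel₀ hy.ne'
  have e : y * -(((n+1:ℝ) - y/4)/y * vv n y) = -(((n+1:ℝ) - y/4) * vv n y) := by field_simp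
  rw [e]
  unfold vv
  obtain ⟨R, P⟩ := ell_PR n y
  linear_combination (((n+1:ℝ)/4)) * (P - R)

lemma FF_succ (n : ℕ) (y : ℝ) : FF (n+1) y = FF n y + ell (n+1) y := by
  rw [FF, Finset.sum_range_succ]; rfl

lemma FF_zero (y : ℝ) : FF 0 y = ell 0 y := by simp [FF]

lemma FF_deriv (n : ℕ) (y : ℝ) (hy : 0 < y) : HasDerivAt (FF n) (vv n y / y) y := by
  induction n with
  | zero =>
    have e : FF 0 = ell 0 := by funext y; exact FF_zero y
    rw [e]
    refine ((ell_diff 0 y).hasDerivAt).congr_deriv ?_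
    rw [ell0_deriv, vv, zero_add, ell_one]
    push_cast
    field_simp
    ring
  | succ n ih =>
    have e : FF (n+1) = fun y => FF n y + ell (n+1) y := by funext y; exact FF_succ n y
    rw [e]
    refine (ih.add (ell_diff (n+1) y).hasDerivAt).congr_deriv ?_
    rw [eq_div_iff hy.ne', add_mul, div_mul_cancel₀ _ hy.ne']
    have R := (ell_PR (n+1) y).1
    have r := ell_rec n y
    unfold vv
    push_cast at *
    rw [show n+1+1 = n+2 from rfl] at *
    linear_combination R - (1/2) * r

lemma WW_zero (y : ℝ) : ww 0 y + ((0:ℕ) + 1 - y/4) * FF 0 y = FF 0 y / 2 := by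
  rw [ww, FF_zero, zero_add, ell_one]
  push_cast; ring

lemma WW_succ (n : ℕ) (y : ℝ) : ww (n+1) y + ((n+1:ℕ) + 1 - y/4) * FF (n+1) y =
   ww n y + (n + 1 - y/4) * FF n y + (FF (n+1) y + FF n y) / 2 := by
  rw [FF_succ, ww, ww]
  have r := ell_rec n y
  push_cast
  rw [show n+1+1 = n+2 from rfl]
  linear_combination (1/4) * r

lemma WW_bounds (n : ℕ) (y : ℝ) (hy : 0 ≤ y) : 0 ≤ ww n y + (n + 1 - y/4) * FF n y ∧
    ww n y + (n + 1 - y/4) * FF n y + FF n y / 2 ≤ ∑ k ∈ Finset.range (n+1), FF k y := by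
  induction n with
  | zero =>
    rw [WW_zero]
    have := FF_nonneg 0 y hy
    simp
    linarith
  | succ n ih =>
    rw [WW_succ, Finset.sum_range_succ]
    have := FF_nonneg n y hy
    have := FF_nonneg (n+1) y hy
    constructor <;> linarith [ih.1, ih.2]

lemma ell_at0 (k : ℕ) : ell k 0 = (-1)^k ∧ ell (k+1) 0 = (-1)^(k+1) := by
  induction k with
  | zero => simp [ell]
  | succ k ih =>
    refine ⟨ih.2, ?_⟩
    have hk : (k:ℝ)+2 ≠ 0 := by positivity
    apply mul_left_cancel₀ hk
    rw [ell_rec, ih.1, ih.2]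
    ring

lemma ell_lim (k : ℕ) : (∀ m : ℕ, Filter.Tendsto (fun y => y^m * ell k y) Filter.atTop (nhds 0)) ∧
    (∀ m : ℕ, Filter.Tendsto (fun y => y^m * ell (k+1) y) Filter.atTop (nhds 0)) := by
  have base : ∀ m : ℕ, Filter.Tendsto (fun y => y^m * ell 0 y) Filter.atTop (nhds 0) := by
    intro m
    have h1 := (Real.tendsto_pow_mul_exp_neg_atTop_nhds_zero m).comp
      (Filter.tendsto_id.atTop_div_const (show (0:ℝ) < 2 by norm_num))
    have h2 := h1.const_mul ((2:ℝ)^m)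
    rw [mul_zero] at h2
    refine h2.congr fun y => ?_
    simp only [Function.comp, id, ell_fun0]
    rw [← mul_assoc, ← mul_pow, neg_div]
    congr 2; field_simp
  induction k with
  | zero =>
    refine ⟨base, fun m => ?_⟩
    have := (base (m+1)).sub (base m)
    rw [sub_zero] at this
    refine this.congr fun y => ?_
    rw [zero_add, ell_one]; ring
  | succ k ih =>
    refine ⟨ih.2, fun m => ?_⟩
    have hk : (k:ℝ)+2 ≠ 0 := by positivity
    have := (((ih.2 (m+1)).sub ((ih.2 m).const_mul (2*(k:ℝ)+3))).sub ((ih.1 m).const_mul ((k:ℝ)+1))).div_const ((k:ℝ)+2)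
    simp only [mul_zero, sub_zero, zero_div] at this
    refine this.congr fun y => ?_
    rw [show k+1+1 = k+2 from rfl, ell_fun2]
    field_simp
    ring

lemma vv_lim (n : ℕ) : Filter.Tendsto (vv n) Filter.atTop (nhds 0) := by
  have := (((ell_lim n).2 0).add ((ell_lim n).1 0)).const_mul (-((n+1:ℝ)/2))
  simp only [add_zero, mul_zero] at this
  refine this.congr fun y => ?_
  simp [vv]

lemma sumF_bound (n : ℕ) (y t : ℝ) (hy : 0 ≤ y) (ht0 : 0 < t) (ht : t ≤ 1/2) :
    ∑ k ∈ Finset.range (n+1), FF k y ≤ 1/t * Real.exp (2*((n+1)-y/4)*t + 4*(n+1)*t^3) := by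
  set r := (1-t)/(1+t) with hr
  have hr0 : 0 < r := div_pos (by linarith) (by linarith)
  have hr1 : r < 1 := by rw [hr, div_lt_one (by linarith)]; linarith
  have h := chernoffF (n+1) y r hy hr0.le hr1
  have hrt : (1-r)/(1+r) = t := by
    rw [hr]; field_simp; ring
  have hr2 : (1-r^2)⁻¹ ≤ 1/t := by
    have e : 1 - r^2 = 4*t/(1+t)^2 := by rw [hr]; field_simp; ring
    rw [e, inv_div, div_le_div_iff₀ (by positivity) ht0]
    have : (1+t)^2 ≤ 4 := by nlinarith
    nlinarith
  rw [hrt] at h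
  have h1 : r^n * ∑ k ∈ Finset.range (n+1), FF k y ≤ ∑ k ∈ Finset.range (n+1), FF k y * r^k := by
    rw [Finset.mul_sum]
    refine Finset.sum_le_sum fun k hk => ?_
    rw [mul_comm]
    refine mul_le_mul_of_nonneg_left ?_ (FF_nonneg k y hy)
    exact pow_le_pow_of_le_one hr0.le hr1.le (by have := Finset.mem_range.mp hk; omega)
  have hlog : 1 ≤ r^n * Real.exp (2*(n+1)*t + 4*(n+1)*t^3) := by
    have hl := Real.log_div_le_sum_range_add ht0.le (by linarith) 1
    simp at hl
    have h3 : t^3/(1-t^2) ≤ 2*t^3 := by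
      rw [div_le_iff₀ (by nlinarith)]
      have : 0 < t^3 := by positivity
      have h9 : 1 ≤ 2*(1-t^2) := by nlinarith
      nlinarith
    have h4 : Real.log ((1+t)/(1-t)) ≤ 2*t+4*t^3 := by linarith
    have h5 : r⁻¹ ≤ Real.exp (2*t+4*t^3) := by
      rw [hr, inv_div]
      have h6 : 0 < (1+t)/(1-t) := div_pos (by linarith) (by linarith)
      calc (1+t)/(1-t) = Real.exp (Real.log ((1+t)/(1-t))) := (Real.exp_log h6).symm
        _ ≤ _ := Real.exp_le_exp.mpr h4
    have h7 : 1 ≤ r * Real.exp (2*t+4*t^3) := by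
      have := mul_le_mul_of_nonneg_left h5 hr0.le
      rwa [mul_inv_cancel₀ hr0.ne'] at this
    have h8 : 1 ≤ (r * Real.exp (2*t+4*t^3))^n := one_le_pow₀ h7
    rw [mul_pow, ← Real.exp_nat_mul] at h8
    refine h8.trans ?_
    refine mul_le_mul_of_nonneg_left (Real.exp_le_exp.mpr ?_) (by positivity)
    have : 0 < t^3 := by positivity
    nlinarith
  have hS : 0 ≤ ∑ k ∈ Finset.range (n+1), FF k y := Finset.sum_nonneg fun k _ => FF_nonneg k y hy
  set Ss := ∑ k ∈ Finset.range (n+1), FF k y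
  set X := Real.exp (2*(n+1)*t + 4*(n+1)*t^3) with hX
  calc Ss ≤ (r^n * X) * Ss := by nlinarith
    _ = X * (r^n * Ss) := by ring
    _ ≤ X * ((1-r^2)⁻¹ * Real.exp (-(y/2)*t)) := mul_le_mul_of_nonneg_left (h1.trans h) (Real.exp_pos _).le
    _ ≤ X * (1/t * Real.exp (-(y/2)*t)) := by gcongr
    _ = 1/t * (X * Real.exp (-(y/2)*t)) := by ring
    _ = _ := by rw [hX, ← Real.exp_add]; congr 2; ring

lemma sumF_bound2 (n : ℕ) (y b : ℝ) (hy : 0 ≤ y) (hb : 1 ≤ b) (hN : b^3 = n+1) :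
    ∑ k ∈ Finset.range (n+1), FF k y ≤ (2*Real.exp (3/2)) * max ((n+1) - y/4) b := by
  set M := max ((n+1:ℝ) - y/4) b with hM
  have hMb : b ≤ M := le_max_right _ _
  have hMQ : (n+1:ℝ) - y/4 ≤ M := le_max_left _ _
  have hM0 : 0 < M := by linarith
  have h := sumF_bound n y (1/(2*M)) hy (by positivity) (by
    rw [div_le_div_iff₀ (by positivity) (by norm_num)]; linarith)
  refine h.trans ?_
  have e : 1/(1/(2*M)) = 2*M := by field_simp
  rw [e]
  have h2 : 2*((n+1:ℝ)-y/4)*(1/(2*M)) ≤ 1 := by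
    have : 2*((n+1:ℝ)-y/4)*(1/(2*M)) = ((n+1:ℝ)-y/4)/M := by field_simp
    rw [this, div_le_one hM0]; exact hMQ
  have h3 : 4*(n+1:ℝ)*(1/(2*M))^3 ≤ 1/2 := by
    have : 4*(n+1:ℝ)*(1/(2*M))^3 = (n+1:ℝ)/(2*M^3) := by field_simp; norm_num
    rw [this, div_le_div_iff₀ (by positivity) (by norm_num), ← hN]
    have : b^3 ≤ M^3 := pow_le_pow_left₀ (by linarith) hMb 3
    linarith
  have h4 := Real.exp_le_exp.mpr (show 2*((n+1:ℝ)-y/4)*(1/(2*M)) + 4*(n+1:ℝ)*(1/(2*M))^3 ≤ 3/2 by linarith)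
  calc _ ≤ 2*M*Real.exp (3/2) := mul_le_mul_of_nonneg_left h4 (by positivity)
    _ = _ := by ring

lemma sys_inst (n : ℕ) : Sys (n+1) ((n+1:ℝ)^(1/3:ℝ)) (2*Real.exp (3/2)) (FF n) (vv n) (ww n) := by
  have hn : (1:ℝ) ≤ (n:ℝ)+1 := le_add_of_nonneg_left (Nat.cast_nonneg n)
  have hb : 1 ≤ (n+1:ℝ)^(1/3:ℝ) := Real.one_le_rpow hn (by norm_num)
  have hN : ((n+1:ℝ)^(1/3:ℝ))^3 = n+1 := by
    rw [← Real.rpow_natCast, ← Real.rpow_mul (by linarith)]; norm_num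
  refine ⟨hb, hN, by positivity, FF_deriv n, vv_deriv n, ww_deriv n, FF_nonneg n,
    fun y hy => (WW_bounds n y hy).1, fun y hy => ?_, vv_lim n, ?_, vv_diff n 0, (ww_diff n 0).continuousAt, ?_⟩
  · have h1 := (WW_bounds n y hy).2
    have h2 := FF_nonneg n y hy
    have h3 := sumF_bound2 n y _ hy hb hN
    linarith
  · rw [vv, (ell_at0 n).1, (ell_at0 n).2]; ring
  · rw [ww, (ell_at0 n).1, (ell_at0 n).2]
    have : ((-1:ℝ)^n)^2 = 1 := by rw [← pow_mul, mul_comm, pow_mul]; simp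
    have e : ((n+1:ℝ)/4*((-1)^(n+1) - (-1)^n))^2 = ((n+1:ℝ)/2)^2 * ((-1:ℝ)^n)^2 := by ring
    rw [e, this, mul_one]

lemma e2_bound : ∃ C : ℝ, 0 < C ∧ ∀ n a b, e2 n a b ≤ C := by
  refine ⟨(4*(2*Real.exp (3/2)) + 2 + Real.sqrt (24 * (Real.exp 6 * (585*(2*Real.exp (3/2))^2))))/Real.pi,
    by positivity, fun n a b => ?_⟩
  rw [le_div_iff₀ Real.pi_pos, mul_comm, e2_eq]
  exact (sys_inst n).bound _ (by positivity)

lemma gen1_pos (x r : ℝ) : 0 ≤ gen1 x r := by unfold gen1; positivity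

lemma gen1_sup (n : ℕ) (hn : 1 ≤ n) (x : ℝ) : gen1 x ((n:ℝ)/(n+1)) ≤ Real.sqrt 2 * Real.sqrt n := by
  have hn1 : (1:ℝ) ≤ n := by exact_mod_cast hn
  set r := (n:ℝ)/(n+1) with hr
  have hr0 : 0 ≤ r := by positivity
  have hr1 : 1 - r = 1/(n+1) := by rw [hr]; field_simp; ring
  have hr2 : 1/(2*(n:ℝ)) ≤ 1 - r^2 := by
    have : 1/(2*(n:ℝ)) ≤ 1 - r := by
      rw [hr1]; apply one_div_le_one_div_of_le <;> linarith
    have h0 : 0 < 1 - r := by rw [hr1]; positivity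
    nlinarith
  have hpi : (Real.sqrt Real.pi)⁻¹ ≤ 1 := by
    apply inv_le_one_of_one_le₀
    rw [Real.one_le_sqrt]; linarith [Real.pi_gt_three]
  have h2 : (Real.sqrt (1-r^2))⁻¹ ≤ Real.sqrt 2 * Real.sqrt n := by
    rw [← Real.sqrt_mul (by norm_num), ← Real.sqrt_inv]
    apply Real.sqrt_le_sqrt
    rw [inv_le_comm₀ (lt_of_lt_of_le (by positivity) hr2) (by positivity)]
    simpa using hr2
  have h3 : Real.exp (-x^2*((1-r)/(1+r))) ≤ 1 := by
    rw [Real.exp_le_one_iff]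
    have : 0 ≤ x^2*((1-r)/(1+r)) := by
      have h0 : 0 < 1 - r := by rw [hr1]; positivity
      positivity
    linarith
  unfold gen1
  calc _ ≤ 1 * (Real.sqrt 2 * Real.sqrt n) * 1 := by gcongr
    _ = _ := by ring

lemma gen1_half (x : ℝ) : gen1 x (1/2) ≤ Real.exp (-x^2/3) := by
  unfold gen1
  have e : (1-(1/2:ℝ))/(1+1/2) = 1/3 := by norm_num
  rw [e, ← mul_inv, ← Real.sqrt_mul Real.pi_pos.le]
  have h : (Real.sqrt (Real.pi * (1 - (1/2)^2)))⁻¹ ≤ 1 := by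
    apply inv_le_one_of_one_le₀
    rw [Real.one_le_sqrt]; linarith [Real.pi_gt_three]
  calc _ ≤ 1 * Real.exp (-x^2*(1/3)) := by gcongr
    _ = _ := by rw [one_mul]; congr 1; ring

lemma sum_eSpec_sup (m n : ℕ) (hn : 1 ≤ n) (z : Fin m → ℝ) :
    ∑ k ∈ Finset.range (n+1), eSpec m k z ≤ Real.exp 1 * (Real.sqrt 2 * Real.sqrt n)^m := by
  have hn1 : (1:ℝ) ≤ n := by exact_mod_cast hn
  set r := (n:ℝ)/(n+1) with hr
  have hr0 : 0 < r := by positivity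
  have hr1 : r < 1 := by rw [hr, div_lt_one (by positivity)]; linarith
  have h := chernoffd m (n+1) z r hr0.le hr1
  have h1 : r^n * ∑ k ∈ Finset.range (n+1), eSpec m k z ≤ ∑ k ∈ Finset.range (n+1), eSpec m k z * r^k := by
    rw [Finset.mul_sum]
    refine Finset.sum_le_sum fun k hk => ?_
    rw [mul_comm]
    refine mul_le_mul_of_nonneg_left ?_ (eSpec_nonneg m k z)
    exact pow_le_pow_of_le_one hr0.le hr1.le (by have := Finset.mem_range.mp hk; omega)
  have h2 : ∏ i, gen1 (z i) r ≤ (Real.sqrt 2 * Real.sqrt n)^m := by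
    calc _ ≤ ∏ i : Fin m, (Real.sqrt 2 * Real.sqrt n) :=
          Finset.prod_le_prod (fun i _ => gen1_pos _ _) (fun i _ => gen1_sup n hn _)
      _ = _ := by simp
  have h3 : 1 ≤ Real.exp 1 * r^n := by
    have a1 : r⁻¹ ≤ Real.exp (1/n) := by
      have : r⁻¹ = 1/n + 1 := by rw [hr]; field_simp; ring
      rw [this]; exact Real.add_one_le_exp _
    have a2 : 1 ≤ Real.exp (1/n) * r := by
      have := mul_le_mul_of_nonneg_right a1 hr0.le
      rwa [inv_mul_cancel₀ hr0.ne'] at this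
    have a3 := one_le_pow₀ a2 (n := n)
    rw [mul_pow, ← Real.exp_nat_mul] at a3
    have : (n:ℝ) * (1/n) = 1 := by field_simp
    rwa [this] at a3
  have hS : 0 ≤ ∑ k ∈ Finset.range (n+1), eSpec m k z := Finset.sum_nonneg fun k _ => eSpec_nonneg m k z
  set Ss := ∑ k ∈ Finset.range (n+1), eSpec m k z
  calc Ss ≤ (Real.exp 1 * r^n) * Ss := by nlinarith
    _ = Real.exp 1 * (r^n * Ss) := by ring
    _ ≤ _ := mul_le_mul_of_nonneg_left ((h1.trans h).trans h2) (Real.exp_pos _).le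

lemma eSpec_decay (d n : ℕ) (x : Fin d → ℝ) :
    eSpec d n x ≤ 2^n * Real.exp (-(∑ i, x i^2)/3) := by
  have h := chernoffd d (n+1) x (1/2) (by norm_num) (by norm_num)
  have h1 : eSpec d n x * (1/2)^n ≤ ∑ k ∈ Finset.range (n+1), eSpec d k x * (1/2)^k :=
    Finset.single_le_sum (f := fun k => eSpec d k x * (1/2:ℝ)^k)
      (fun k _ => mul_nonneg (eSpec_nonneg d k x) (by positivity)) (Finset.mem_range.mpr (Nat.lt_succ_self n))
  have h2 : ∏ i, gen1 (x i) (1/2) ≤ Real.exp (-(∑ i, x i^2)/3) := by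
    calc _ ≤ ∏ i, Real.exp (-x i^2/3) :=
          Finset.prod_le_prod (fun i _ => gen1_pos _ _) (fun i _ => gen1_half _)
      _ = _ := by rw [← Real.exp_sum, ← Finset.sum_div, Finset.sum_neg_distrib]
  have h3 := (h1.trans h).trans h2
  have : (2:ℝ)^n * (1/2)^n = 1 := by rw [← mul_pow]; norm_num
  calc eSpec d n x = 2^n * (eSpec d n x * (1/2)^n) := by linear_combination (-eSpec d n x) * this
    _ ≤ _ := mul_le_mul_of_nonneg_left h3 (by positivity)

lemma eSpec_sup (m : ℕ) : ∃ C : ℝ, 0 < C ∧ ∀ n : ℕ, 1 ≤ n → ∀ x : Fin (m+2) → ℝ,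
    eSpec (m+2) n x ≤ C * (Real.sqrt n)^m := by
  obtain ⟨C, hC, h⟩ := e2_bound
  refine ⟨C * (Real.exp 1 * Real.sqrt 2^m), by positivity, fun n hn x => ?_⟩
  rw [eSpec_succ_succ]
  set z := Fin.tail (Fin.tail x)
  calc _ ≤ ∑ p ∈ Finset.HasAntidiagonal.antidiagonal n, C * eSpec m p.2 z :=
        Finset.sum_le_sum fun p _ => mul_le_mul_of_nonneg_right (h _ _ _) (eSpec_nonneg _ _ _)
    _ = C * ∑ k ∈ Finset.range (n+1), eSpec m k z := by
      rw [← Finset.mul_sum, ← Finset.Nat.sum_antidiagonal_swap,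
        Finset.Nat.sum_antidiagonal_eq_sum_range_succ_mk]
      rfl
    _ ≤ C * (Real.exp 1 * (Real.sqrt 2 * Real.sqrt n)^m) :=
      mul_le_mul_of_nonneg_left (sum_eSpec_sup m n hn z) hC.le
    _ = _ := by rw [mul_pow]; ring

lemma eSpec_pt (m : ℕ) : ∃ C : ℝ, 0 < C ∧ ∀ n : ℕ, 1 ≤ n → ∀ x : Fin (m+2) → ℝ,
    eSpec (m+2) n x ≤ C * (Real.sqrt n)^m * Real.exp (-(∑ i, x i^2)/(6*n)) := by
  obtain ⟨C, hC, h⟩ := eSpec_sup m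
  refine ⟨C * Real.exp 1 + 1, by positivity, fun n hn x => ?_⟩
  have hn1 : (1:ℝ) ≤ n := by exact_mod_cast hn
  have hs : 1 ≤ (Real.sqrt n)^m := one_le_pow₀ (by rw [Real.one_le_sqrt]; exact hn1)
  set s := ∑ i, x i^2 with hsdef
  have hs0 : 0 ≤ s := Finset.sum_nonneg fun i _ => sq_nonneg _
  rcases le_total s (6*n) with h1 | h1
  · have : 1 ≤ Real.exp 1 * Real.exp (-s/(6*n)) := by
      rw [← Real.exp_add]
      apply Real.one_le_exp
      have : s/(6*n) ≤ 1 := by rw [div_le_one (by positivity)]; exact h1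
      rw [neg_div]; linarith
    calc _ ≤ C * (Real.sqrt n)^m * 1 := by rw [mul_one]; exact h n hn x
      _ ≤ C * (Real.sqrt n)^m * (Real.exp 1 * Real.exp (-s/(6*n))) :=
        mul_le_mul_of_nonneg_left this (by positivity)
      _ = (C * Real.exp 1) * (Real.sqrt n)^m * Real.exp (-s/(6*n)) := by ring
      _ ≤ _ := by gcongr; linarith
  · have h2 : (2:ℝ)^n ≤ Real.exp (s/6) := by
      calc (2:ℝ)^n ≤ (Real.exp 1)^n := pow_le_pow_left₀ (by norm_num) (by linarith [Real.add_one_le_exp (1:ℝ)]) n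
        _ = Real.exp n := by rw [← Real.exp_nat_mul, mul_one]
        _ ≤ _ := Real.exp_le_exp.mpr (by linarith)
    have h3 : -s/6 ≤ -s/(6*n) := by
      rw [neg_div, neg_div]
      have : s/(6*n) ≤ s/6 := by gcongr; linarith
      linarith
    calc _ ≤ 2^n * Real.exp (-s/3) := eSpec_decay _ n x
      _ ≤ Real.exp (s/6) * Real.exp (-s/3) := by gcongr
      _ = Real.exp (-s/6) := by rw [← Real.exp_add]; congr 1; ring
      _ ≤ Real.exp (-s/(6*n)) := Real.exp_le_exp.mpr h3
      _ = 1 * 1 * Real.exp (-s/(6*n)) := by ring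
      _ ≤ _ := by
        gcongr
        have : 0 < C * Real.exp 1 := by positivity
        linarith

lemma poly_gauss_int (q : Polynomial ℝ) : Integrable (fun x : ℝ => q.eval x * Real.exp (-x^2)) volume := by
  induction q using Polynomial.induction_on' with
  | add p q hp hq =>
    refine (hp.add hq).congr (Filter.Eventually.of_forall fun x => ?_)
    simp only [Polynomial.eval_add, Pi.add_apply]; ring
  | monomial k a =>
    have h := (integrable_rpow_mul_exp_neg_mul_sq (b := 1) one_pos (s := (k:ℝ))
      (by have : (0:ℝ) ≤ k := Nat.cast_nonneg k
          linarith)).const_mul a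
    refine h.congr (Filter.Eventually.of_forall fun x => ?_)
    simp only [Polynomial.eval_monomial, Real.rpow_natCast, neg_mul, one_mul]; ring

lemma Hq_norm (n : ℕ) : ∫ x : ℝ, (Hq n).eval x ^2 * Real.exp (-x^2) = n.factorial * 2^n * Real.sqrt Real.pi := by
  induction n with
  | zero =>
    have := integral_gaussian 1
    simpa [Hq] using this
  | succ n ih =>
    have hg : ∀ x : ℝ, HasDerivAt (fun x : ℝ => (Hq n).eval x * Real.exp (-x^2)) (-((Hq (n+1)).eval x * Real.exp (-x^2))) x := by
      intro x
      have h1 := (Hq n).hasDerivAt x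
      have h2 : HasDerivAt (fun x : ℝ => Real.exp (-x^2)) (Real.exp (-x^2) * (-(2*x))) x := by
        have : HasDerivAt (fun x : ℝ => -x^2) (-(2*x)) x := by
          have h3 := (hasDerivAt_pow 2 x).neg
          refine h3.congr_deriv ?_
          simp
        exact this.exp
      refine (h1.mul h2).congr_deriv ?_
      simp [Hq]
      ring
    have key := integral_mul_deriv_eq_deriv_mul_of_integrable
      (u := fun x => (Hq (n+1)).eval x) (u' := fun x => (Polynomial.derivative (Hq (n+1))).eval x)
      (v := fun x : ℝ => (Hq n).eval x * Real.exp (-x^2))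
      (v' := fun x => -((Hq (n+1)).eval x * Real.exp (-x^2)))
      (fun x _ => (Hq (n+1)).hasDerivAt x) (fun x _ => hg x)
      (by
        refine (poly_gauss_int (-(Hq (n+1) * Hq (n+1)))).congr (Filter.Eventually.of_forall fun x => ?_)
        simp; ring)
      (by
        refine (poly_gauss_int (Polynomial.derivative (Hq (n+1)) * Hq n)).congr (Filter.Eventually.of_forall fun x => ?_)
        simp; ring)
      (by
        refine (poly_gauss_int ((Hq (n+1)) * Hq n)).congr (Filter.Eventually.of_forall fun x => ?_)
        simp; ring)
    have e1 : ∫ x : ℝ, (Hq (n+1)).eval x * -((Hq (n+1)).eval x * Real.exp (-x^2)) =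
        - ∫ x : ℝ, (Hq (n+1)).eval x ^2 * Real.exp (-x^2) := by
      rw [← integral_neg]; congr 1; funext x; ring
    have e2 : ∫ x : ℝ, (Polynomial.derivative (Hq (n+1))).eval x * ((Hq n).eval x * Real.exp (-x^2)) =
        2*(n+1) * ∫ x : ℝ, (Hq n).eval x ^2 * Real.exp (-x^2) := by
      rw [← integral_const_mul]; congr 1; funext x
      rw [Hq_deriv]; simp; ring
    rw [e1, e2, ih] at key
    rw [neg_inj.mp key, Nat.factorial_succ]
    push_cast; ring

lemma ha_int (n : ℕ) : Integrable (ha n) volume := by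
  have := (poly_gauss_int (Hq n * Hq n)).div_const (n.factorial * 2^n * Real.sqrt Real.pi)
  refine this.congr (Filter.Eventually.of_forall fun x => ?_)
  simp [ha_eq]; ring

lemma ha_integral (n : ℕ) : ∫ x, ha n x = 1 := by
  simp_rw [ha_eq]
  rw [integral_div, Hq_norm, div_self]
  positivity

lemma ha_cont (n : ℕ) : Continuous (ha n) := by
  have : ha n = fun x => (Hq n).eval x ^2 * Real.exp (-x^2) / (n.factorial * 2^n * Real.sqrt Real.pi) := by
    funext x; exact ha_eq n x
  rw [this]
  fun_prop

lemma eSpec_ha (d n : ℕ) (x : Fin d → ℝ) : eSpec d n x =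
    ∑ i ∈ Finset.Nat.antidiagonalTuple d n, ∏ k, ha (i k) (x k) := rfl

lemma eSpec_cont (d n : ℕ) : Continuous (eSpec d n) := by
  have h := ha_cont
  have : eSpec d n = fun x => ∑ i ∈ Finset.Nat.antidiagonalTuple d n, ∏ k, ha (i k) (x k) := rfl
  rw [this]
  fun_prop

lemma prod_int (d : ℕ) (i : Fin d → ℕ) :
    Integrable (fun x : Fin d → ℝ => ∏ k, ha (i k) (x k)) volume :=
  Integrable.fintype_prod (f := fun k => ha (i k)) (fun k => ha_int (i k))

lemma eSpec_int (d n : ℕ) : Integrable (eSpec d n) volume := by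
  have : eSpec d n = fun x => ∑ i ∈ Finset.Nat.antidiagonalTuple d n, ∏ k, ha (i k) (x k) := rfl
  rw [this]
  refine integrable_finsetSum _ fun i _ => ?_
  exact prod_int d i

lemma eSpec_integral (d n : ℕ) : ∫ x, eSpec d n x = (Finset.Nat.antidiagonalTuple d n).card := by
  simp_rw [eSpec_ha]
  rw [integral_finsetSum _ (fun i _ => prod_int d i)]
  have : ∀ i : Fin d → ℕ, ∫ x : Fin d → ℝ, ∏ k, ha (i k) (x k) = 1 := by
    intro i
    rw [integral_fintype_prod_volume_eq_prod (fun k => ha (i k))]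
    simp [ha_integral]
  simp [this]

lemma card_tuple (m n : ℕ) : n^m ≤ m.factorial * (Finset.Nat.antidiagonalTuple (m+1) n).card := by
  have h : ∀ n, (Finset.Nat.antidiagonalTuple (m+1) n).card = (n+m).choose m := by
    induction m with
    | zero => intro n; simp
    | succ m ih =>
      intro n
      rw [Finset.card_eq_sum_ones, sum_tuple_succ]
      simp only [← Finset.card_eq_sum_ones, ih]
      rw [← Finset.Nat.sum_antidiagonal_swap,
        Finset.Nat.sum_antidiagonal_eq_sum_range_succ_mk]
      simp only [Prod.snd_swap]
      rw [Nat.sum_range_add_choose]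
      rfl
  rw [h]
  have := Nat.ascFactorial_eq_factorial_mul_choose n m
  have h2 := Nat.pow_succ_le_ascFactorial (n+1) m
  have h3 : n^m ≤ (n+1)^m := Nat.pow_le_pow_left (Nat.le_succ n) m
  rw [← this]
  exact h3.trans h2

lemma eSpec_mass (m n : ℕ) : (n:ℝ)^(m+1) / (m+1).factorial ≤ ∫ x, eSpec (m+2) n x := by
  rw [eSpec_integral, div_le_iff₀ (by positivity), mul_comm]
  exact_mod_cast card_tuple (m+1) n

lemma gauss_prod (d : ℕ) (a : ℝ) (x : Fin d → ℝ) : Real.exp (-a * ∑ i, x i^2) = ∏ i, Real.exp (-a * x i^2) := by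
  rw [← Real.exp_sum, Finset.mul_sum]

lemma gauss_int (d : ℕ) (a : ℝ) (ha : 0 < a) :
    Integrable (fun x : Fin d → ℝ => Real.exp (-a * ∑ i, x i^2)) volume := by
  simp_rw [gauss_prod]
  exact Integrable.fintype_prod (f := fun _ y => Real.exp (-a * y^2)) (fun k => integrable_exp_neg_mul_sq ha)

lemma gauss_integral (d : ℕ) (a : ℝ) :
    ∫ x : Fin d → ℝ, Real.exp (-a * ∑ i, x i^2) = (Real.sqrt (Real.pi/a))^d := by
  simp_rw [gauss_prod]
  rw [integral_fintype_prod_volume_eq_prod (fun _ y => Real.exp (-a * y^2))]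
  simp only [integral_gaussian, Finset.prod_const, Finset.card_univ, Fintype.card_fin]

lemma core (m : ℕ) (p : ℝ) (hp : 1 ≤ p) : ∃ C k1 k2 : ℝ, 0 < C ∧ 0 < k1 ∧ 0 < k2 ∧ ∀ n : ℕ, 1 ≤ n →
    Integrable (fun x : Fin (m+2) → ℝ => (Real.sqrt (eSpec (m+2) n x))^p) volume ∧
    k1 * (Real.sqrt (C * Real.sqrt n^m))^p * Real.sqrt n^(m+2) ≤ ∫ x, (Real.sqrt (eSpec (m+2) n x))^p ∧
    ∫ x, (Real.sqrt (eSpec (m+2) n x))^p ≤ k2 * (Real.sqrt (C * Real.sqrt n^m))^p * Real.sqrt n^(m+2) := by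
  obtain ⟨C, hC, hpt⟩ := eSpec_pt m
  set D := Real.sqrt (12*Real.pi)^(m+2) with hD
  have hD0 : 0 < D := by positivity
  set q : ℝ := 1/(2*C*(m+1).factorial) with hq
  have hq0 : 0 < q := by positivity
  set δ := q / D with hδ
  have hδ0 : 0 < δ := by positivity
  have hp0 : 0 < p := by linarith
  refine ⟨C, δ^p * q, Real.sqrt (12*Real.pi/p)^(m+2), hC, by positivity, by positivity, fun n hn => ?_⟩
  have hn1 : (1:ℝ) ≤ n := by exact_mod_cast hn
  have hn0 : (0:ℝ) < n := by linarith
  set B := C * Real.sqrt n^m with hB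
  have hB0 : 0 < B := by positivity
  set f : (Fin (m+2) → ℝ) → ℝ := fun x => Real.sqrt (eSpec (m+2) n x) with hf
  have hf0 : ∀ x, 0 ≤ f x := fun x => Real.sqrt_nonneg _
  set g : (Fin (m+2) → ℝ) → ℝ := fun x => Real.exp (-(1/(12*n)) * ∑ i, x i^2) with hg
  have hfg : ∀ x, f x ≤ Real.sqrt B * g x := by
    intro x
    rw [hf]
    apply Real.sqrt_le_iff.mpr
    refine ⟨by positivity, ?_⟩
    rw [mul_pow, Real.sq_sqrt hB0.le, hg]
    refine (hpt n hn x).trans (le_of_eq ?_)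
    simp only
    rw [← Real.exp_nat_mul]
    congr 2
    push_cast
    field_simp
    ring
  have hcont : Continuous f := (eSpec_cont (m+2) n).sqrt
  have hfp : ∀ x, (f x)^p ≤ (Real.sqrt B)^p * Real.exp (-(p/(12*n)) * ∑ i, x i^2) := by
    intro x
    refine (Real.rpow_le_rpow (hf0 x) (hfg x) hp0.le).trans (le_of_eq ?_)
    rw [Real.mul_rpow (by positivity) (by positivity), hg]
    simp only
    rw [← Real.exp_mul]
    congr 2
    field_simp
  have hgi := (gauss_int (m+2) (p/(12*n)) (by positivity)).const_mul ((Real.sqrt B)^p)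
  have hfi : Integrable (fun x => (f x)^p) volume := by
    refine hgi.mono' ?_ (Filter.Eventually.of_forall fun x => ?_)
    · exact (hcont.rpow_const (fun x => Or.inr hp0.le)).aestronglyMeasurable
    · rw [Real.norm_of_nonneg (Real.rpow_nonneg (hf0 x) p)]
      exact hfp x
  refine ⟨hfi, ?_, ?_⟩
  · have hptw : ∀ x, eSpec (m+2) n x ≤ B * (δ * g x) + B * ((δ * Real.sqrt B)^p)⁻¹ * (f x)^p := by
      intro x
      have he : eSpec (m+2) n x = (f x)^2 := (Real.sq_sqrt (eSpec_nonneg _ _ _)).symm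
      rw [he]
      have hg1 : g x ≤ 1 := by
        rw [hg]; simp only
        rw [Real.exp_le_one_iff]
        have : 0 ≤ (1/(12*n)) * ∑ i, x i^2 :=
          mul_nonneg (by positivity) (Finset.sum_nonneg fun i _ => sq_nonneg _)
        linarith
      have hg0 : 0 < g x := Real.exp_pos _
      have hsB : 0 < Real.sqrt B := Real.sqrt_pos.mpr hB0
      have hBB : Real.sqrt B * Real.sqrt B = B := Real.mul_self_sqrt hB0.le
      have h0 := hf0 x
      have h1 := hfg x
      rcases le_total (f x) (δ * Real.sqrt B) with h | h
      · have : (f x)^2 ≤ (δ * Real.sqrt B) * (Real.sqrt B * g x) := by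
          rw [sq]; exact mul_le_mul h h1 h0 (by positivity)
        have e : (δ * Real.sqrt B) * (Real.sqrt B * g x) = B * (δ * g x) := by
          linear_combination (δ * g x) * hBB
        have : 0 ≤ B * ((δ * Real.sqrt B)^p)⁻¹ * (f x)^p := by positivity
        linarith
      · have h2 : (f x)^2 ≤ B := by
          have : f x ≤ Real.sqrt B := h1.trans (by nlinarith)
          calc (f x)^2 ≤ (Real.sqrt B)^2 := pow_le_pow_left₀ h0 this 2
            _ = B := Real.sq_sqrt hB0.le
        have h3 : 1 ≤ ((δ * Real.sqrt B)^p)⁻¹ * (f x)^p := by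
          have : 0 < (δ * Real.sqrt B)^p := by positivity
          rw [inv_mul_eq_div, le_div_iff₀ this, one_mul]
          exact Real.rpow_le_rpow (by positivity) h hp0.le
        have : 0 ≤ B * (δ * g x) := by positivity
        nlinarith
    have hgi1 := gauss_int (m+2) (1/(12*n)) (by positivity)
    have hint := integral_mono (eSpec_int (m+2) n)
      (((hgi1.const_mul δ).const_mul B).add (hfi.const_mul (B * ((δ * Real.sqrt B)^p)⁻¹))) hptw
    have hsplit : ∫ x, (B * (δ * g x) + B * ((δ * Real.sqrt B)^p)⁻¹ * (f x)^p) =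
        B * (δ * ∫ x, g x) + B * ((δ * Real.sqrt B)^p)⁻¹ * ∫ x, (f x)^p := by
      rw [integral_add ((hgi1.const_mul δ).const_mul B) (hfi.const_mul (B * ((δ * Real.sqrt B)^p)⁻¹)),
        integral_const_mul, integral_const_mul, integral_const_mul]
    have hint2 : ∫ x, eSpec (m+2) n x ≤ B * (δ * ∫ x, g x) + B * ((δ * Real.sqrt B)^p)⁻¹ * ∫ x, (f x)^p := by
      rw [← hsplit]; exact hint
    have hgint : ∫ x, g x = D * Real.sqrt n^(m+2) := by
      rw [hg, gauss_integral, hD, ← mul_pow, ← Real.sqrt_mul (by positivity)]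
      congr 2; field_simp
    have hmass := eSpec_mass m n
    have hmass2 : (n:ℝ)^(m+1) / (m+1).factorial = B * (2 * q * Real.sqrt n^(m+2)) := by
      rw [hB, hq]
      have : (n:ℝ)^(m+1) = Real.sqrt n^m * Real.sqrt n^(m+2) := by
        rw [← pow_add, show m+(m+2) = 2*(m+1) by ring, pow_mul, Real.sq_sqrt hn0.le]
      rw [this]; field_simp
    rw [hmass2] at hmass
    rw [hgint] at hint2
    have hδD : δ * (D * Real.sqrt n^(m+2)) = q * Real.sqrt n^(m+2) := by rw [hδ]; field_simp
    rw [hδD] at hint2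
    set I := ∫ x, (f x)^p
    have h9 : B * (q * Real.sqrt n^(m+2)) ≤ B * (((δ * Real.sqrt B)^p)⁻¹ * I) := by linarith
    have h10 := le_of_mul_le_mul_left h9 hB0
    have hpos : 0 < (δ * Real.sqrt B)^p := by
      have := Real.sqrt_pos.mpr hB0
      positivity
    rw [inv_mul_eq_div, le_div_iff₀ hpos, Real.mul_rpow hδ0.le (Real.sqrt_nonneg _)] at h10
    linarith
  · have := integral_mono hfi hgi hfp
    refine this.trans (le_of_eq ?_)
    rw [integral_const_mul, gauss_integral, mul_comm, mul_right_comm]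
    congr 1
    rw [← mul_pow, ← Real.sqrt_mul (by positivity)]
    congr 2; field_simp

lemma stmt_aux (m : ℕ) (p : ℝ) (hp : 1 ≤ p) :
    ∃ C : ℝ, 1 ≤ C ∧
      ∀ n : ℕ, 1 ≤ n →
        ENNReal.ofReal ((n : ℝ) ^ ((1 / 2 : ℝ) * (((m+2:ℕ) : ℝ) / 2 - 1 + ((m+2:ℕ) : ℝ) / p)) / C)
            ≤ eLpNorm (fun x : Fin (m+2) → ℝ => Real.sqrt (eSpec (m+2) n x)) (ENNReal.ofReal p) volume
        ∧ eLpNorm (fun x : Fin (m+2) → ℝ => Real.sqrt (eSpec (m+2) n x)) (ENNReal.ofReal p) volume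
            ≤ ENNReal.ofReal (C * (n : ℝ) ^ ((1 / 2 : ℝ) * (((m+2:ℕ) : ℝ) / 2 - 1 + ((m+2:ℕ) : ℝ) / p))) := by
  obtain ⟨C, k1, k2, hC, hk1, hk2, h⟩ := core m p hp
  have hp0 : 0 < p := by linarith
  set c1 := k1^(p⁻¹) * Real.sqrt C with hc1
  set c2 := k2^(p⁻¹) * Real.sqrt C with hc2
  have hc1p : 0 < c1 := by positivity
  have hc2p : 0 < c2 := by positivity
  refine ⟨max 1 (max c2 c1⁻¹), le_max_left _ _, fun n hn => ?_⟩
  set K := max 1 (max c2 c1⁻¹) with hK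
  have hK1 : 1 ≤ K := le_max_left _ _
  have hKc2 : c2 ≤ K := (le_max_left _ _).trans (le_max_right _ _)
  have hKc1 : c1⁻¹ ≤ K := (le_max_right _ _).trans (le_max_right _ _)
  have hn1 : (1:ℝ) ≤ n := by exact_mod_cast hn
  have hn0 : (0:ℝ) < n := by linarith
  obtain ⟨hint, hlo, hhi⟩ := h n hn
  set s := ((1 / 2 : ℝ) * (((m+2:ℕ) : ℝ) / 2 - 1 + ((m+2:ℕ) : ℝ) / p)) with hs
  have hsq : Real.sqrt n = (n:ℝ)^(1/2:ℝ) := Real.sqrt_eq_rpow _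
  have key : ∀ k : ℝ, 0 < k → (k * (Real.sqrt (C * Real.sqrt n^m))^p * Real.sqrt n^(m+2))^(p⁻¹) =
      k^(p⁻¹) * Real.sqrt C * (n:ℝ)^s := by
    intro k hk
    rw [Real.mul_rpow (by positivity) (by positivity), Real.mul_rpow (by positivity) (by positivity),
      Real.rpow_rpow_inv (by positivity) hp0.ne', Real.sqrt_mul hC.le]
    have e1 : Real.sqrt (Real.sqrt n^m) = (n:ℝ)^((m:ℝ)/4) := by
      rw [hsq, ← Real.rpow_natCast, ← Real.rpow_mul hn0.le, Real.sqrt_eq_rpow, ← Real.rpow_mul hn0.le]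
      congr 1; ring
    have e2 : (Real.sqrt n^(m+2))^(p⁻¹) = (n:ℝ)^(((m+2:ℕ):ℝ)/(2*p)) := by
      rw [hsq, ← Real.rpow_natCast, ← Real.rpow_mul hn0.le, ← Real.rpow_mul hn0.le]
      congr 1; field_simp
    rw [e1, e2]
    have e3 : (n:ℝ)^s = (n:ℝ)^((m:ℝ)/4) * (n:ℝ)^(((m+2:ℕ):ℝ)/(2*p)) := by
      rw [← Real.rpow_add hn0]
      congr 1
      rw [hs]; push_cast; field_simp; ring
    rw [e3]; ring
  have hpt : (ENNReal.ofReal p).toReal = p := ENNReal.toReal_ofReal hp0.le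
  have hpne : ENNReal.ofReal p ≠ 0 := by simpa using hp0
  have hmem : MemLp (fun x : Fin (m+2) → ℝ => Real.sqrt (eSpec (m+2) n x)) (ENNReal.ofReal p) volume := by
    rw [← integrable_norm_rpow_iff ((eSpec_cont (m+2) n).sqrt).aestronglyMeasurable hpne ENNReal.ofReal_ne_top, hpt]
    simpa only [Real.norm_of_nonneg (Real.sqrt_nonneg _)] using hint
  rw [hmem.eLpNorm_eq_integral_rpow_norm hpne ENNReal.ofReal_ne_top, hpt]
  simp only [Real.norm_of_nonneg (Real.sqrt_nonneg _)]
  have hns : 0 < (n:ℝ)^s := by positivity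
  have hinv : 0 ≤ p⁻¹ := by positivity
  constructor
  · apply ENNReal.ofReal_le_ofReal
    have := Real.rpow_le_rpow (by positivity) hlo hinv
    rw [key k1 hk1] at this
    refine le_trans ?_ this
    rw [div_le_iff₀ (by linarith)]
    have h2 : 1 ≤ c1 * K := by
      have := mul_le_mul_of_nonneg_left hKc1 hc1p.le
      rwa [mul_inv_cancel₀ hc1p.ne'] at this
    rw [← hc1]
    nlinarith
  · apply ENNReal.ofReal_le_ofReal
    have h0 : 0 ≤ ∫ x, (Real.sqrt (eSpec (m+2) n x))^p :=
      integral_nonneg fun x => Real.rpow_nonneg (Real.sqrt_nonneg _) p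
    have := Real.rpow_le_rpow h0 hhi hinv
    rw [key k2 hk2] at this
    exact this.trans (mul_le_mul_of_nonneg_right hKc2 hns.le)


/-- estimates (47): for every `p ∈ [1, ∞)`,
`‖√(e_d(n,·))‖_{L^p(ℝ^d)} ≃ n^{(1/2)(d/2 − 1 + d/p)}`. -/
theorem stmt11 (d : ℕ) (hd : 2 ≤ d) (p : ℝ) (hp : 1 ≤ p) :
    ∃ C : ℝ, 1 ≤ C ∧
      ∀ n : ℕ, 1 ≤ n →
        ENNReal.ofReal ((n : ℝ) ^ ((1 / 2 : ℝ) * ((d : ℝ) / 2 - 1 + (d : ℝ) / p)) / C)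
            ≤ eLpNorm (fun x : Fin d → ℝ => Real.sqrt (eSpec d n x)) (ENNReal.ofReal p) volume
        ∧ eLpNorm (fun x : Fin d → ℝ => Real.sqrt (eSpec d n x)) (ENNReal.ofReal p) volume
            ≤ ENNReal.ofReal (C * (n : ℝ) ^ ((1 / 2 : ℝ) * ((d : ℝ) / 2 - 1 + (d : ℝ) / p))) := by
  obtain ⟨m, rfl⟩ : ∃ m, d = m + 2 := ⟨d - 2, by omega⟩
  exact stmt_aux m p hp
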